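/- arXiv:2502.06526 — 2 statements merged into one kernel-verified Lean document; each statement's English description precedes it below -/
import Mathlib

section
/- Let ε, α ∈ (0,1), β > 1, and let ρ be a density matrix on a bipartite system A⊗B. Then I_max^ε(A:B)_ρ ≤ H_α(A)_ρ − H̃_β↑(A|B)_ρ + f_{α,β}(ε), where f_{α,β}(ε) := (2/(β−1) + 1/(1−α))·log(1/(c·ε²)) with c := 2 − √3. -/
open scoped Matrix Kronecker BigOperators ENNReal ComplexOrder Classical

noncomputable section

variable {d : Type*} [Fintype d] [DecidableEq d]

/-- Apply a real function to the eigenvalues of a Hermitian matrix (spectral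
functional calculus). -/
def herFun {A : Matrix d d ℂ} (hA : A.IsHermitian) (f : ℝ → ℝ) : Matrix d d ℂ :=
  (hA.eigenvectorUnitary : Matrix d d ℂ) *
    Matrix.diagonal (fun i => (f (hA.eigenvalues i) : ℂ)) *
    (hA.eigenvectorUnitary : Matrix d d ℂ)ᴴ

/-- Functional calculus, extended by the junk value `0` to non-Hermitian matrices. -/
def matFun (A : Matrix d d ℂ) (f : ℝ → ℝ) : Matrix d d ℂ :=
  if h : A.IsHermitian then herFun h f else 0

/-- Real power of a Hermitian matrix, taken on its support (Moore–Penrose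
convention: zero eigenvalues are sent to zero; negative powers are pseudo-inverses). -/
def matPow (A : Matrix d d ℂ) (r : ℝ) : Matrix d d ℂ :=
  matFun A (fun x => if x = 0 then 0 else Real.rpow x r)

/-- Logarithm of a Hermitian matrix on its support. -/
def matLog (A : Matrix d d ℂ) : Matrix d d ℂ := matFun A Real.log

/-- A density matrix: positive semidefinite with unit trace. -/
def IsDensity (A : Matrix d d ℂ) : Prop := A.PosSemidef ∧ A.trace = 1

/-- `suppLE ρ σ` : the support of `ρ` is contained in the support of `σ`
(for Hermitian matrices this is equivalent to `ker σ ≤ ker ρ`). -/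
def suppLE (ρ σ : Matrix d d ℂ) : Prop :=
  LinearMap.ker σ.mulVecLin ≤ LinearMap.ker ρ.mulVecLin

/-- Trace (nuclear) norm of a matrix: `Tr √(AᴴA)`. -/
def traceNorm (A : Matrix d d ℂ) : ℝ := (Matrix.trace (matPow (Aᴴ * A) (1/2))).re

/-- The real-valued collision quantity `Tr[ρ σ^{-1/2} ρ σ^{-1/2}]`. -/
def Q2R (ρ σ : Matrix d d ℂ) : ℝ :=
  (Matrix.trace (ρ * matPow σ (-(1/2)) * ρ * matPow σ (-(1/2)))).re

/-- `Q₂(ρ‖σ) = Tr[ρ σ^{-1/2} ρ σ^{-1/2}]`, equal to `+∞` unless `supp ρ ⊆ supp σ`. -/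
def Q2 (ρ σ : Matrix d d ℂ) : ℝ≥0∞ :=
  if suppLE ρ σ then ENNReal.ofReal (Q2R ρ σ) else ∞

/-- Collision relative entropy `D₂(ρ‖σ) = log Q₂(ρ‖σ)`. -/
def D2 (ρ σ : Matrix d d ℂ) : EReal := ENNReal.log (Q2 ρ σ)

/-- Fidelity `F(ρ,σ) = ‖√ρ √σ‖₁`. -/
def fidelity (ρ σ : Matrix d d ℂ) : ℝ := traceNorm (matPow ρ (1/2) * matPow σ (1/2))

/-- Purified distance `P(ρ,σ) = √(1 - F(ρ,σ)²)`. -/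
def purifiedDist (ρ σ : Matrix d d ℂ) : ℝ := Real.sqrt (1 - fidelity ρ σ ^ 2)

/-- Max relative entropy `D_max(ρ‖σ) = log inf{t ≥ 0 : ρ ≤ t·σ}` (`+∞` if no such `t`). -/
def Dmax (ρ σ : Matrix d d ℂ) : EReal :=
  ENNReal.log (sInf {t : ℝ≥0∞ | t ≠ ∞ ∧ (t.toReal • σ - ρ).PosSemidef})

/-- The smallest nonzero eigenvalue of a matrix. -/
def lambdaMinPos (M : Matrix d d ℂ) : ℝ :=
  sInf {x : ℝ | x ≠ 0 ∧ (x : ℂ) ∈ spectrum ℂ M}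

variable {A B : Type*} [Fintype A] [DecidableEq A] [Fintype B] [DecidableEq B]

/-- Partial trace over the second tensor factor. -/
def ptrace2 (ρ : Matrix (A × B) (A × B) ℂ) : Matrix A A ℂ :=
  Matrix.of fun i j => ∑ b : B, ρ (i, b) (j, b)

/-- Max mutual information `I_max(A:B)_ρ = min_σ D_max(ρ ‖ ρ^A ⊗ σ)`. -/
def Imax (ρ : Matrix (A × B) (A × B) ℂ) : EReal :=
  ⨅ σ : {σ : Matrix B B ℂ // IsDensity σ}, Dmax ρ (ptrace2 ρ ⊗ₖ σ.1)

/-- Optimized conditional min-entropy `H_min(A|B)_ρ = −min_σ D_max(ρ ‖ I_A ⊗ σ)`. -/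
def Hmin (ρ : Matrix (A × B) (A × B) ℂ) : EReal :=
  -(⨅ σ : {σ : Matrix B B ℂ // IsDensity σ}, Dmax ρ ((1 : Matrix A A ℂ) ⊗ₖ σ.1))

/-- Smoothed max mutual information
`I_max^ε(A:B)_ρ = min { I_max(A:B)_ρ' : (1/2)‖ρ − ρ'‖₁ ≤ ε }`. -/
def ImaxSmooth (ε : ℝ) (ρ : Matrix (A × B) (A × B) ℂ) : EReal :=
  ⨅ ρ' : {ρ' : Matrix (A × B) (A × B) ℂ //
      IsDensity ρ' ∧ (1/2) * traceNorm (ρ - ρ') ≤ ε}, Imax ρ'.1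

/-- Rényi entropy of order `α`: `H_α(τ) = (1/(1−α))·log Tr[τ^α]`. -/
def renyiEntropy (α : ℝ) (τ : Matrix d d ℂ) : ℝ :=
  (1 / (1 - α)) * Real.log ((matPow τ α).trace.re)

/-- The quantity `Q_β(ρ‖σ) = Tr[(σ^{(1−β)/(2β)} ρ σ^{(1−β)/(2β)})^β]`, with powers of `σ`
taken on its support (Moore–Penrose pseudoinverse). -/
def QaR (β : ℝ) (ρ σ : Matrix d d ℂ) : ℝ :=
  (Matrix.trace (matPow (matPow σ ((1 - β) / (2 * β)) * ρ * matPow σ ((1 - β) / (2 * β))) β)).re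

/-- Sandwiched Rényi relative entropy of order `β`:
`D_β(ρ‖σ) = (1/(β−1))·log Q_β(ρ‖σ)`, `+∞` unless `supp ρ ⊆ supp σ`. -/
def Dbeta (β : ℝ) (ρ σ : Matrix d d ℂ) : EReal :=
  if suppLE ρ σ then (((β - 1)⁻¹ * Real.log (QaR β ρ σ) : ℝ) : EReal) else ⊤

/-- Optimized conditional Rényi entropy `H̃_β↑(A|B)_ρ = −min_σ D_β(ρ ‖ I_A ⊗ σ)`. -/
def HbetaUp {A B : Type*} [Fintype A] [DecidableEq A] [Fintype B] [DecidableEq B]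
    (β : ℝ) (ρ : Matrix (A × B) (A × B) ℂ) : EReal :=
  -(⨅ σ : {σ : Matrix B B ℂ // IsDensity σ}, Dbeta β ρ ((1 : Matrix A A ℂ) ⊗ₖ σ.1))


namespace UB

/-! ### Basic facts on the spectral functional calculus -/

lemma unit_left {M : Matrix d d ℂ} (h : M.IsHermitian) :
    (h.eigenvectorUnitary : Matrix d d ℂ)ᴴ * (h.eigenvectorUnitary : Matrix d d ℂ) = 1 := by
  have := Unitary.coe_star_mul_self h.eigenvectorUnitary
  simpa [Matrix.star_eq_conjTranspose] using this

lemma unit_right {M : Matrix d d ℂ} (h : M.IsHermitian) :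
    (h.eigenvectorUnitary : Matrix d d ℂ) * (h.eigenvectorUnitary : Matrix d d ℂ)ᴴ = 1 := by
  have := Unitary.coe_mul_star_self h.eigenvectorUnitary
  simpa [Matrix.star_eq_conjTranspose] using this

lemma herFun_id {M : Matrix d d ℂ} (h : M.IsHermitian) : herFun h (fun x => x) = M := by
  have := h.spectral_theorem
  rw [Unitary.conjStarAlgAut_apply] at this
  exact this.symm

lemma herFun_mul {M : Matrix d d ℂ} (h : M.IsHermitian) (f g : ℝ → ℝ) :
    herFun h f * herFun h g = herFun h (fun x => f x * g x) := by
  unfold herFun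
  set U := (h.eigenvectorUnitary : Matrix d d ℂ) with hU
  have h1 : Uᴴ * U = 1 := unit_left h
  calc _ = U * Matrix.diagonal (fun i => (f (h.eigenvalues i) : ℂ)) * (Uᴴ * U) *
        Matrix.diagonal (fun i => (g (h.eigenvalues i) : ℂ)) * Uᴴ := by
        simp only [Matrix.mul_assoc]
    _ = _ := by
        rw [h1, Matrix.mul_one, Matrix.mul_assoc U, Matrix.diagonal_mul_diagonal]
        simp

lemma herFun_add {M : Matrix d d ℂ} (h : M.IsHermitian) (f g : ℝ → ℝ) :
    herFun h f + herFun h g = herFun h (fun x => f x + g x) := by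
  unfold herFun
  rw [← Matrix.add_mul, ← Matrix.mul_add, Matrix.diagonal_add]
  simp

lemma herFun_congr {M : Matrix d d ℂ} (h : M.IsHermitian) {f g : ℝ → ℝ}
    (hfg : ∀ i, f (h.eigenvalues i) = g (h.eigenvalues i)) : herFun h f = herFun h g := by
  unfold herFun
  simp [hfg]

lemma herFun_one {M : Matrix d d ℂ} (h : M.IsHermitian) : herFun h (fun _ => 1) = 1 := by
  unfold herFun
  simp [unit_right h]

lemma herFun_smul {M : Matrix d d ℂ} (h : M.IsHermitian) (c : ℝ) (f : ℝ → ℝ) :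
    herFun h (fun x => c * f x) = c • herFun h f := by
  unfold herFun
  have : Matrix.diagonal (fun i => ((c * f (h.eigenvalues i) : ℝ) : ℂ))
      = c • Matrix.diagonal (fun i => ((f (h.eigenvalues i) : ℝ) : ℂ)) := by
    ext i j
    by_cases hij : i = j
    · subst hij; simp
    · simp [hij]
  rw [this, Matrix.mul_smul, Matrix.smul_mul]

lemma herFun_posSemidef {M : Matrix d d ℂ} (h : M.IsHermitian) {f : ℝ → ℝ}
    (hf : ∀ i, 0 ≤ f (h.eigenvalues i)) : (herFun h f).PosSemidef := by
  unfold herFun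
  apply Matrix.PosSemidef.mul_mul_conjTranspose_same
  apply Matrix.PosSemidef.diagonal
  intro i
  simpa using hf i

lemma herFun_isHermitian {M : Matrix d d ℂ} (h : M.IsHermitian) (f : ℝ → ℝ) :
    (herFun h f).IsHermitian := by
  unfold herFun
  apply Matrix.isHermitian_mul_mul_conjTranspose
  rw [Matrix.IsHermitian, Matrix.diagonal_conjTranspose]
  congr 1
  ext i
  simp

lemma herFun_trace {M : Matrix d d ℂ} (h : M.IsHermitian) (f : ℝ → ℝ) :
    (herFun h f).trace.re = ∑ i, f (h.eigenvalues i) := by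
  unfold herFun
  rw [Matrix.mul_assoc, Matrix.trace_mul_comm, Matrix.mul_assoc, unit_left, Matrix.mul_one,
    Matrix.trace_diagonal]
  simp

lemma matFun_eq {M : Matrix d d ℂ} (h : M.IsHermitian) (f : ℝ → ℝ) :
    matFun M f = herFun h f := by
  unfold matFun
  simp [h]

lemma matPow_eq {M : Matrix d d ℂ} (h : M.IsHermitian) (r : ℝ) :
    matPow M r = herFun h (fun x => if x = 0 then 0 else x ^ r) := by
  unfold matPow
  rw [matFun_eq h]
  rfl

/-- Traces of products of positive semidefinite matrices are nonnegative. -/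
lemma tr_mul_nonneg {X Y : Matrix d d ℂ} (hX : X.PosSemidef) (hY : Y.PosSemidef) :
    0 ≤ (X * Y).trace.re := by
  have h2 : herFun hX.1 Real.sqrt * herFun hX.1 Real.sqrt = X := by
    rw [herFun_mul]
    conv_rhs => rw [← herFun_id hX.1]
    apply herFun_congr
    intro i
    exact Real.mul_self_sqrt (hX.eigenvalues_nonneg i)
  set S := herFun hX.1 Real.sqrt with hS
  have hSh : Sᴴ = S := herFun_isHermitian hX.1 _
  rw [← h2, Matrix.mul_assoc, Matrix.trace_mul_comm]
  have h3 := hY.mul_mul_conjTranspose_same S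
  rw [hSh] at h3
  have := h3.trace_nonneg
  exact (Complex.le_def.1 this).1

lemma tr_mul_mono {X Y Z : Matrix d d ℂ} (hX : X.PosSemidef) (hYZ : (Z - Y).PosSemidef) :
    (X * Y).trace.re ≤ (X * Z).trace.re := by
  have := tr_mul_nonneg hX hYZ
  rw [Matrix.mul_sub, Matrix.trace_sub, Complex.sub_re] at this
  linarith

lemma tr_nonneg {X : Matrix d d ℂ} (hX : X.PosSemidef) : 0 ≤ X.trace.re :=
  (Complex.le_def.1 hX.trace_nonneg).1

lemma tr_conj (X : Matrix d d ℂ) : (Xᴴ).trace.re = X.trace.re := by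
  rw [Matrix.trace_conjTranspose]; simp

/-- Hermitian idempotents are positive semidefinite. -/
lemma proj_psd {X : Matrix d d ℂ} (h1 : Xᴴ = X) (h2 : X * X = X) : X.PosSemidef := by
  have := Matrix.posSemidef_conjTranspose_mul_self X
  rwa [h1, h2] at this

lemma psd_real_smul {X : Matrix d d ℂ} (hX : X.PosSemidef) {c : ℝ} (hc : 0 ≤ c) :
    (c • X).PosSemidef := by
  have h := hX.smul (α := ℂ) (a := (c : ℂ)) (by simpa using hc)
  have : (c : ℂ) • X = c • X := by ext i j; simp
  rwa [this] at h

/-- Jensen's inequality for the diagonal of a compressed functional calculus. -/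
lemma jensen_diag {M : Matrix d d ℂ} (h : M.IsHermitian) {f : ℝ → ℝ}
    (hf : ∀ i, 0 ≤ f (h.eigenvalues i)) {p : ℝ} (hp : 1 ≤ p) (V : Matrix d d ℂ) (j : d)
    (hV : ((Vᴴ * V) j j).re ≤ 1) :
    ((Vᴴ * herFun h f * V) j j).re ^ p ≤ ((Vᴴ * herFun h (fun x => f x ^ p) * V) j j).re := by
  set U := (h.eigenvectorUnitary : Matrix d d ℂ) with hU
  set W := Uᴴ * V with hW
  have hform : ∀ g : ℝ → ℝ, ((Vᴴ * herFun h g * V) j j).re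
      = ∑ k, Complex.normSq (W k j) * g (h.eigenvalues k) := by
    intro g
    have : Vᴴ * herFun h g * V
        = Wᴴ * (Matrix.diagonal (fun i => (g (h.eigenvalues i) : ℂ)) * W) := by
      unfold herFun
      rw [hW, Matrix.conjTranspose_mul, Matrix.conjTranspose_conjTranspose]
      simp only [Matrix.mul_assoc, hU]
    rw [this, Matrix.mul_apply, Complex.re_sum]
    refine Finset.sum_congr rfl fun k _ => ?_
    rw [Matrix.diagonal_mul, Matrix.conjTranspose_apply]
    simp [Complex.normSq_apply]
    ring
  have hsum : ∑ k, Complex.normSq (W k j) ≤ 1 := by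
    have := hform (fun _ => 1)
    rw [herFun_one, Matrix.mul_one] at this
    simp only [mul_one] at this
    linarith
  rw [hform, hform]
  have hw0 : ∀ k, 0 ≤ Complex.normSq (W k j) := fun k => Complex.normSq_nonneg _
  have hJ := Real.rpow_arith_mean_le_arith_mean_rpow (Finset.univ : Finset (Option d))
    (fun o => o.elim (1 - ∑ k, Complex.normSq (W k j)) (fun k => Complex.normSq (W k j)))
    (fun o => o.elim 0 (fun k => f (h.eigenvalues k)))
    (by
      intro o _
      cases o with
      | none => simpa using hsum
      | some k => exact hw0 k)
    (by simp [Fintype.sum_option])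
    (by
      intro o _
      cases o with
      | none => simp
      | some k => exact hf k) hp
  have hp0 : p ≠ 0 := by linarith
  simpa [Fintype.sum_option, Real.zero_rpow hp0] using hJ

end UB

namespace UB

/-- The projection on the support does not change a matrix supported there. -/
lemma mul_supp {ρ τ : Matrix d d ℂ} (hτ : τ.IsHermitian) (hs : suppLE ρ τ) :
    ρ * herFun hτ (fun x => if x = 0 then 0 else 1) = ρ := by
  have h1 : τ * herFun hτ (fun x => if x = 0 then 1 else 0) = 0 := by
    conv_lhs => enter [1]; rw [← herFun_id hτ]
    rw [herFun_mul]
    have : herFun hτ (fun x => x * if x = 0 then 1 else 0) = herFun hτ (fun x => 0 * 1) := by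
      apply herFun_congr
      intro i
      split_ifs with h <;> simp [h]
    rw [this, herFun_smul, zero_smul]
  have h2 : ρ * herFun hτ (fun x => if x = 0 then 1 else 0) = 0 := by
    ext i j
    set N := herFun hτ (fun x => if x = 0 then 1 else 0) with hN
    have h3 : τ.mulVecLin (N.col j) = 0 := by
      rw [Matrix.mulVecLin_apply]
      ext k
      have := congrFun (congrFun h1 k) j
      rw [Matrix.mul_apply] at this
      simpa [Matrix.mulVec, dotProduct] using this
    have h4 := hs (LinearMap.mem_ker.2 h3)
    have h5 := congrFun (LinearMap.mem_ker.1 h4) i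
    rw [Matrix.mul_apply]
    simpa [Matrix.mulVec, dotProduct] using h5
  have h3 : herFun hτ (fun x => if x = 0 then 0 else 1)
      + herFun hτ (fun x => if x = 0 then 1 else 0) = 1 := by
    rw [herFun_add, ← herFun_one hτ]
    apply herFun_congr
    intro i
    split_ifs <;> simp
  calc ρ * herFun hτ (fun x => if x = 0 then 0 else 1)
      = ρ * herFun hτ (fun x => if x = 0 then 0 else 1)
        + ρ * herFun hτ (fun x => if x = 0 then 1 else 0) := by rw [h2, add_zero]
    _ = ρ := by rw [← Matrix.mul_add, h3, Matrix.mul_one]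

lemma diag_re_mono {X Y : Matrix d d ℂ} (h : (Y - X).PosSemidef) (j : d) :
    (X j j).re ≤ (Y j j).re := by
  have := (Complex.le_def.1 (h.diag_nonneg (i := j))).1
  simp at this
  linarith

set_option maxHeartbeats 2000000 in
/-- The `ℓ^q` part of the Hölder argument: for `Y = S W Wᴴ S` with `S = τ^{1/(2q)}` and a
contraction `W`, the sum of `q`-th powers of eigenvalues of `Y` is at most `Tr τ W Wᴴ`. -/
lemma sum_eig_pow_le {τ W : Matrix d d ℂ} (hτ : τ.PosSemidef)
    (hW : (1 - Wᴴ * W).PosSemidef) {q : ℝ} (hq : 1 < q) {g : ℝ → ℝ}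
    (hg : ∀ x, 0 ≤ x → (g x * g x) ^ q = x)
    (hY : (herFun hτ.1 g * W * Wᴴ * herFun hτ.1 g).IsHermitian)
    (hY0 : ∀ i, 0 ≤ hY.eigenvalues i) :
    ∑ i, hY.eigenvalues i ^ q ≤ (τ * (W * Wᴴ)).trace.re := by
  set S := herFun hτ.1 g with hS
  have hSh : Sᴴ = S := herFun_isHermitian hτ.1 g
  set Y := S * W * Wᴴ * S with hYdef
  set U := (hY.eigenvectorUnitary : Matrix d d ℂ) with hU
  set y := hY.eigenvalues with hy
  have hUU : Uᴴ * U = 1 := unit_left hY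
  have hUU' : U * Uᴴ = 1 := unit_right hY
  have hYU : Uᴴ * Y * U = Matrix.diagonal (fun i => (y i : ℂ)) := by
    have h1 : U * Matrix.diagonal (fun i => (y i : ℂ)) * Uᴴ = Y := herFun_id hY
    calc Uᴴ * Y * U = Uᴴ * (U * Matrix.diagonal (fun i => (y i : ℂ)) * Uᴴ) * U := by rw [h1]
      _ = (Uᴴ * U) * Matrix.diagonal (fun i => (y i : ℂ)) * (Uᴴ * U) := by
        simp only [Matrix.mul_assoc]
      _ = _ := by rw [hUU]; simp
  set D : Matrix d d ℂ := Matrix.diagonal (fun i => (((Real.sqrt (y i))⁻¹ : ℝ) : ℂ)) with hD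
  have hDh : Dᴴ = D := by
    rw [hD, Matrix.diagonal_conjTranspose]
    congr 1
    ext i
    simp
  set Z := Wᴴ * S * U * D with hZ
  have hZh : Zᴴ = D * Uᴴ * S * W := by
    rw [hZ]
    simp only [Matrix.conjTranspose_mul, hDh, hSh, Matrix.conjTranspose_conjTranspose,
      Matrix.mul_assoc]
  set E : Matrix d d ℂ := Matrix.diagonal (fun i => if y i = 0 then 0 else 1) with hE
  have hZZ : Zᴴ * Z = E := by
    have h1 : Zᴴ * Z = D * (Uᴴ * Y * U) * D := by
      rw [hZh, hZ, hYdef]; simp only [Matrix.mul_assoc]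
    rw [h1, hYU, hD, Matrix.diagonal_mul_diagonal, Matrix.diagonal_mul_diagonal, hE]
    congr 1
    ext i
    split_ifs with h
    · simp [h]
    · have hpos : 0 < y i := lt_of_le_of_ne (hY0 i) (Ne.symm h)
      have h2 : Real.sqrt (y i) ≠ 0 := (Real.sqrt_pos.2 hpos).ne'
      rw [← Complex.ofReal_mul, ← Complex.ofReal_mul]
      norm_cast
      have h3 := Real.mul_self_sqrt hpos.le
      field_simp
      nlinarith
  have hZE : Z * E = Z := by
    have : D * E = D := by
      rw [hD, hE, Matrix.diagonal_mul_diagonal]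
      congr 1
      ext i
      split_ifs with h
      · simp [h]
      · simp
    rw [hZ, Matrix.mul_assoc, this]
  have hpr : (1 - Z * Zᴴ).PosSemidef := by
    have hi : (Z * Zᴴ) * (Z * Zᴴ) = Z * Zᴴ := by
      calc (Z * Zᴴ) * (Z * Zᴴ) = Z * (Zᴴ * Z) * Zᴴ := by simp only [Matrix.mul_assoc]
        _ = _ := by rw [hZZ, hZE]
    apply proj_psd
    · simp
    · rw [Matrix.sub_mul, Matrix.mul_sub, Matrix.mul_sub, hi]; simp
  set V := W * Z with hV
  have hVh : Vᴴ = Zᴴ * Wᴴ := Matrix.conjTranspose_mul _ _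
  have hVV : ∀ j, ((Vᴴ * V) j j).re ≤ 1 := by
    intro j
    have h1 : (Zᴴ * Z - Vᴴ * V).PosSemidef := by
      have h2 := hW.conjTranspose_mul_mul_same Z
      have h3 : Zᴴ * (1 - Wᴴ * W) * Z = Zᴴ * Z - Vᴴ * V := by
        rw [hVh, hV, Matrix.mul_sub, Matrix.sub_mul, Matrix.mul_one]
        simp only [Matrix.mul_assoc]
      rwa [h3] at h2
    refine (diag_re_mono h1 j).trans ?_
    rw [hZZ, hE, Matrix.diagonal_apply_eq]
    split_ifs <;> simp
  have hVS : ∀ j, ((Vᴴ * herFun hτ.1 (fun x => g x * g x) * V) j j).re = y j := by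
    intro j
    have h1 : Vᴴ * herFun hτ.1 (fun x => g x * g x) * V
        = D * (Uᴴ * Y * U) * (Uᴴ * Y * U) * D := by
      rw [← herFun_mul]
      calc Vᴴ * (S * S) * V = D * (Uᴴ * Y * 1 * Y * U) * D := by
            rw [hVh, hV, hZh, hZ, hYdef]
            simp only [Matrix.mul_assoc, Matrix.one_mul]
        _ = _ := by
            rw [← hUU']; simp only [Matrix.mul_assoc]
    rw [h1, hYU, hD, Matrix.diagonal_mul_diagonal, Matrix.diagonal_mul_diagonal,
      Matrix.diagonal_mul_diagonal, Matrix.diagonal_apply_eq]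
    rw [← Complex.ofReal_mul, ← Complex.ofReal_mul, ← Complex.ofReal_mul, Complex.ofReal_re]
    rcases (hY0 j).eq_or_lt with h | h
    · change 0 = y j at h
      rw [← h]; simp
    · have h2 : Real.sqrt (y j) ≠ 0 := (Real.sqrt_pos.2 h).ne'
      have h3 := Real.mul_self_sqrt h.le
      change Real.sqrt (y j) * Real.sqrt (y j) = y j at h3
      field_simp
      nlinarith
  have hτid : herFun hτ.1 (fun x => (g x * g x) ^ q) = τ := by
    conv_rhs => rw [← herFun_id hτ.1]
    apply herFun_congr
    intro i
    exact hg _ (hτ.eigenvalues_nonneg i)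
  have hstep : ∀ j, y j ^ q ≤ ((Vᴴ * τ * V) j j).re := by
    intro j
    have := jensen_diag hτ.1 (f := fun x => g x * g x) (fun i => mul_self_nonneg _) hq.le V j (hVV j)
    rw [hVS, hτid] at this
    exact this
  calc ∑ i, y i ^ q ≤ ∑ j, ((Vᴴ * τ * V) j j).re := Finset.sum_le_sum fun j _ => hstep j
    _ = (Vᴴ * τ * V).trace.re := by rw [Matrix.trace, Complex.re_sum]; rfl
    _ = ((Wᴴ * τ * W) * (Z * Zᴴ)).trace.re := by
        rw [hVh, hV]
        congr 1
        rw [show Zᴴ * Wᴴ * τ * (W * Z) = Zᴴ * ((Wᴴ * τ * W) * Z) by simp only [Matrix.mul_assoc],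
          Matrix.trace_mul_comm]
        simp only [Matrix.mul_assoc]
    _ ≤ ((Wᴴ * τ * W) * 1).trace.re := tr_mul_mono (hτ.conjTranspose_mul_mul_same W) hpr
    _ = (τ * (W * Wᴴ)).trace.re := by
        rw [Matrix.mul_one, Matrix.mul_assoc, Matrix.trace_mul_comm]
        simp only [Matrix.mul_assoc]

lemma trace_aux {ρ R S : Matrix d d ℂ} (h1 : ρ * (R * S) = ρ) (h2 : (S * R) * ρ = ρ)
    (W : Matrix d d ℂ) :
    (ρ * (W * Wᴴ)).trace = ((R * ρ * R) * (S * W * Wᴴ * S)).trace := by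
  have e : ρ * (W * Wᴴ) = S * (R * ρ * R * (S * W * Wᴴ)) := by
    calc ρ * (W * Wᴴ) = (S * R) * (ρ * (R * S)) * (W * Wᴴ) := by rw [h1, h2]
      _ = _ := by simp only [Matrix.mul_assoc]
  rw [e, Matrix.trace_mul_comm]
  simp only [Matrix.mul_assoc]

lemma trace_aux2 (X U D : Matrix d d ℂ) :
    (X * (U * D * Uᴴ)).trace = (Uᴴ * X * U * D).trace := by
  rw [← Matrix.mul_assoc, Matrix.trace_mul_comm]
  simp only [Matrix.mul_assoc]

set_option maxHeartbeats 2000000 in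
/-- The measured data-processing inequality for the sandwiched quantity `Q_β`. -/
lemma holder_test {ρ τ W : Matrix d d ℂ} (hρ : ρ.PosSemidef) (hτ : τ.PosSemidef)
    (hs : suppLE ρ τ) (hW : (1 - Wᴴ * W).PosSemidef) {β : ℝ} (hβ : 1 < β) :
    0 ≤ QaR β ρ τ ∧ (ρ * (W * Wᴴ)).trace.re ^ β
      ≤ QaR β ρ τ * (τ * (W * Wᴴ)).trace.re ^ (β - 1) := by
  set r : ℝ := (β - 1) / (2 * β) with hr
  have hβ0 : 0 < β := by linarith
  have hr' : (1 - β) / (2 * β) = -r := by rw [hr]; ring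
  have hr0 : 0 < r := by rw [hr]; apply div_pos <;> linarith
  set q : ℝ := β / (β - 1) with hqdef
  have hb1 : 0 < β - 1 := by linarith
  have hq : 1 < q := by rw [hqdef, lt_div_iff₀ hb1]; linarith
  have hconj : Real.HolderConjugate q β := by
    rw [Real.holderConjugate_iff]
    refine ⟨hq, ?_⟩
    rw [hqdef]; field_simp; ring
  have hrq : (r + r) * q = 1 := by rw [hr, hqdef]; field_simp; ring
  set g : ℝ → ℝ := fun x => if x = 0 then 0 else x ^ r with hg
  have hgx : ∀ x, 0 ≤ x → (g x * g x) ^ q = x := by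
    intro x hx
    rcases hx.eq_or_lt with h | h
    · rw [← h]; simp [hg, Real.zero_rpow (by linarith : q ≠ 0)]
    · simp only [hg, h.ne', if_false]
      rw [← Real.rpow_add h, ← Real.rpow_mul h.le, hrq, Real.rpow_one]
  set S := herFun hτ.1 g with hS
  set R := herFun hτ.1 (fun x => if x = 0 then 0 else x ^ (-r)) with hR
  have hSh : Sᴴ = S := herFun_isHermitian hτ.1 _
  have hRh : Rᴴ = R := herFun_isHermitian hτ.1 _
  have hRS : R * S = herFun hτ.1 (fun x => if x = 0 then 0 else 1) := by
    rw [hR, hS, herFun_mul]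
    apply herFun_congr
    intro i
    have := hτ.eigenvalues_nonneg i
    simp only [hg]
    split_ifs with h
    · simp
    · have hpos := lt_of_le_of_ne this (Ne.symm h)
      rw [← Real.rpow_add hpos]; simp
  have hρRS : ρ * (R * S) = ρ := by rw [hRS]; exact mul_supp hτ.1 hs
  have hSRρ : (S * R) * ρ = ρ := by
    have := congrArg Matrix.conjTranspose hρRS
    rw [Matrix.conjTranspose_mul, Matrix.conjTranspose_mul, hSh, hRh, hρ.1.eq] at this
    exact this
  set X := R * ρ * R with hX
  have hXp : X.PosSemidef := by
    have := hρ.mul_mul_conjTranspose_same R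
    rwa [hRh] at this
  set Y := S * W * Wᴴ * S with hY
  have hYp : Y.PosSemidef := by
    have := Matrix.posSemidef_self_mul_conjTranspose (S * W)
    rw [Matrix.conjTranspose_mul, hSh] at this
    have e : S * W * (Wᴴ * S) = Y := by rw [hY]; simp only [Matrix.mul_assoc]
    rwa [e] at this
  have hQ : QaR β ρ τ = (herFun hXp.1 (fun x => x ^ β)).trace.re := by
    unfold QaR
    rw [hr', matPow_eq hτ.1, ← hR, ← hX, matPow_eq hXp.1]
    congr 2
    apply herFun_congr
    intro i
    split_ifs with h
    · rw [h, Real.zero_rpow hβ0.ne']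
    · rfl
  set U := (hYp.1.eigenvectorUnitary : Matrix d d ℂ) with hU
  set y := hYp.1.eigenvalues with hy
  have hUU : Uᴴ * U = 1 := unit_left hYp.1
  have hUU' : U * Uᴴ = 1 := unit_right hYp.1
  have hy0 : ∀ i, 0 ≤ y i := hYp.eigenvalues_nonneg
  set x : d → ℝ := fun j => ((Uᴴ * X * U) j j).re with hx
  have hx0 : ∀ j, 0 ≤ x j := fun j =>
    (Complex.le_def.1 ((hXp.conjTranspose_mul_mul_same U).diag_nonneg (i := j))).1
  have hxsum : ∑ j, x j ^ β ≤ QaR β ρ τ := by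
    calc ∑ j, x j ^ β ≤ ∑ j, ((Uᴴ * herFun hXp.1 (fun x => x ^ β) * U) j j).re := by
          refine Finset.sum_le_sum fun j _ => ?_
          have := jensen_diag hXp.1 (f := fun x => x) hXp.eigenvalues_nonneg hβ.le U j
            (by rw [hUU]; simp)
          rwa [herFun_id] at this
      _ = (Uᴴ * herFun hXp.1 (fun x => x ^ β) * U).trace.re := by
          rw [Matrix.trace, Complex.re_sum]; rfl
      _ = _ := by
          rw [hQ, Matrix.trace_mul_comm, ← Matrix.mul_assoc, hUU', Matrix.one_mul]
  have hQ0 : 0 ≤ QaR β ρ τ :=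
    le_trans (Finset.sum_nonneg fun j _ => Real.rpow_nonneg (hx0 j) _) hxsum
  refine ⟨hQ0, ?_⟩
  have hysum : ∑ i, y i ^ q ≤ (τ * (W * Wᴴ)).trace.re :=
    sum_eig_pow_le hτ hW hq hgx hYp.1 hy0
  have htr : (ρ * (W * Wᴴ)).trace.re = ∑ j, y j * x j := by
    have h1 : (ρ * (W * Wᴴ)).trace = (X * Y).trace := by
      exact trace_aux hρRS hSRρ W
    have h2 : U * Matrix.diagonal (fun i => (y i : ℂ)) * Uᴴ = Y := herFun_id hYp.1
    rw [h1, ← h2]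
    have h3 := trace_aux2 X U (Matrix.diagonal (fun i => (y i : ℂ)))
    rw [h3, Matrix.trace, Complex.re_sum]
    refine Finset.sum_congr rfl fun j _ => ?_
    rw [Matrix.diag_apply, Matrix.mul_diagonal]
    rw [Complex.re_mul_ofReal]
    exact mul_comm _ _
  have hH := Real.inner_le_Lp_mul_Lq_of_nonneg (s := Finset.univ) hconj
    (f := y) (g := x) (fun i _ => hy0 i) (fun i _ => hx0 i)
  rw [← htr] at hH
  set b := (τ * (W * Wᴴ)).trace.re with hb
  set Q := QaR β ρ τ with hQd
  have hys0 : 0 ≤ ∑ i, y i ^ q := Finset.sum_nonneg fun j _ => Real.rpow_nonneg (hy0 j) _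
  have hxs0 : 0 ≤ ∑ i, x i ^ β := Finset.sum_nonneg fun j _ => Real.rpow_nonneg (hx0 j) _
  have hb0 : 0 ≤ b := hys0.trans hysum
  have ha0 : 0 ≤ (ρ * (W * Wᴴ)).trace.re := by
    rw [htr]; exact Finset.sum_nonneg fun j _ => mul_nonneg (hy0 j) (hx0 j)
  have hH2 : (ρ * (W * Wᴴ)).trace.re ≤ b ^ (1 / q) * Q ^ (1 / β) := by
    refine hH.trans ?_
    apply mul_le_mul
    · exact Real.rpow_le_rpow hys0 hysum (by positivity)
    · exact Real.rpow_le_rpow hxs0 hxsum (by positivity)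
    · exact Real.rpow_nonneg hxs0 _
    · exact Real.rpow_nonneg hb0 _
  calc (ρ * (W * Wᴴ)).trace.re ^ β ≤ (b ^ (1 / q) * Q ^ (1 / β)) ^ β :=
        Real.rpow_le_rpow ha0 hH2 hβ0.le
    _ = Q * b ^ (β - 1) := by
        rw [Real.mul_rpow (Real.rpow_nonneg hb0 _) (Real.rpow_nonneg hQ0 _),
          ← Real.rpow_mul hb0, ← Real.rpow_mul hQ0]
        have e1 : 1 / q * β = β - 1 := by rw [hqdef]; field_simp
        have e2 : 1 / β * β = 1 := by field_simp
        rw [e1, e2, Real.rpow_one, mul_comm]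

end UB

namespace UB

section sqrts

open scoped MatrixOrder Matrix.Norms.L2Operator

lemma exists_sqrts {Λ M : Matrix d d ℂ} (hΛ : Λ.PosSemidef) (hM : M.PosSemidef)
    (h : (M - Λ).PosSemidef) :
    ∃ S R : Matrix d d ℂ, S.PosSemidef ∧ R.PosSemidef ∧ S * S = Λ ∧ R * R = M ∧
      (R - S).PosSemidef := by
  refine ⟨CFC.sqrt Λ, CFC.sqrt M, ?_, ?_, ?_, ?_, ?_⟩
  · exact Matrix.nonneg_iff_posSemidef.1 (CFC.sqrt_nonneg Λ)
  · exact Matrix.nonneg_iff_posSemidef.1 (CFC.sqrt_nonneg M)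
  · exact CFC.sqrt_mul_sqrt_self Λ hΛ.nonneg
  · exact CFC.sqrt_mul_sqrt_self M hM.nonneg
  · exact Matrix.le_iff.1 (CFC.sqrt_le_sqrt Λ M (Matrix.le_iff.2 h))

lemma sqrt_uniq {X Y : Matrix d d ℂ} (hX : X.PosSemidef) (hY : Y.PosSemidef)
    (h : X * X = Y * Y) : X = Y :=
  (CFC.mul_self_eq_mul_self_iff X Y hX.nonneg hY.nonneg).1 h

end sqrts

/-- The trace norm of a traceless Hermitian matrix is attained by a projective test. -/
lemma traceNorm_test {H : Matrix d d ℂ} (hH : H.IsHermitian) (htr : H.trace.re = 0) :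
    ∃ Q : Matrix d d ℂ, Qᴴ = Q ∧ Q * Q = Q ∧ (1 / 2) * traceNorm H = (Q * H).trace.re := by
  refine ⟨herFun hH (fun x => if 0 < x then 1 else 0), herFun_isHermitian hH _, ?_, ?_⟩
  · rw [herFun_mul]
    apply herFun_congr
    intro i
    split_ifs <;> simp
  have hC : (Hᴴ * H).PosSemidef := Matrix.posSemidef_conjTranspose_mul_self H
  have h1 : matPow (Hᴴ * H) (1 / 2) = herFun hH (fun x => |x|) := by
    rw [matPow_eq hC.1]
    apply sqrt_uniq
    · apply herFun_posSemidef
      intro i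
      split_ifs
      · exact le_rfl
      · exact Real.rpow_nonneg (hC.eigenvalues_nonneg i) _
    · apply herFun_posSemidef
      intro i
      exact abs_nonneg _
    · rw [herFun_mul, herFun_mul]
      have e1 : herFun hH (fun x => |x| * |x|) = H * H := by
        conv_rhs => rw [← herFun_id hH]
        rw [herFun_mul]
        apply herFun_congr
        intro i
        exact abs_mul_abs_self _
      rw [e1]
      have e2 : H * H = Hᴴ * H := by rw [hH.eq]
      rw [e2]
      conv_rhs => rw [← herFun_id hC.1]
      apply herFun_congr
      intro i
      have h0 := hC.eigenvalues_nonneg i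
      split_ifs with h
      · simp [h]
      · rw [← Real.rpow_add (lt_of_le_of_ne h0 (Ne.symm h))]
        norm_num
  have h2 : herFun hH (fun x => if 0 < x then 1 else 0) * H
      = herFun hH (fun x => (1 / 2) * (|x| + x)) := by
    conv_lhs => enter [2]; rw [← herFun_id hH]
    rw [herFun_mul]
    apply herFun_congr
    intro i
    split_ifs with h
    · rw [abs_of_pos h]; ring
    · rw [abs_of_nonpos (not_lt.1 h)]; ring
  have h3 : ∑ i, hH.eigenvalues i = 0 := by
    have := herFun_trace hH (fun x => x)
    rw [herFun_id, htr] at this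
    exact this.symm
  unfold traceNorm
  rw [h1, h2, herFun_trace, herFun_trace, ← Finset.mul_sum, Finset.sum_add_distrib, h3, add_zero]

/-- Cauchy–Schwarz for the form `Tr T X ρ Yᴴ`. -/
lemma cs_test {T ρ : Matrix d d ℂ} (hT : T.PosSemidef) (hρ : ρ.PosSemidef) (K : Matrix d d ℂ) :
    (T * (K * ρ)).trace.re ^ 2 ≤ (T * ρ).trace.re * (T * (K * ρ * Kᴴ)).trace.re := by
  have key : ∀ z : ℝ, 0 ≤ (T * (K * ρ * Kᴴ)).trace.re * (z * z)
      + (-2 * (T * (K * ρ)).trace.re) * z + (T * ρ).trace.re := by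
    intro z
    have h1 := tr_mul_nonneg hT (hρ.mul_mul_conjTranspose_same (1 - (z : ℂ) • K))
    have h2 : (1 - (z : ℂ) • K) * ρ * (1 - (z : ℂ) • K)ᴴ
        = ρ - (z : ℂ) • (K * ρ) - (z : ℂ) • (ρ * Kᴴ) + (z : ℂ) • (z : ℂ) • (K * ρ * Kᴴ) := by
      rw [Matrix.conjTranspose_sub, Matrix.conjTranspose_smul, Matrix.conjTranspose_one]
      simp only [Matrix.sub_mul, Matrix.mul_sub, Matrix.one_mul, Matrix.mul_one, Matrix.smul_mul,
        Matrix.mul_smul, RCLike.star_def, Complex.conj_ofReal, smul_sub]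
      abel
    have h3 : (T * (ρ * Kᴴ)).trace.re = (T * (K * ρ)).trace.re := by
      rw [← tr_conj (T * (ρ * Kᴴ))]
      simp only [Matrix.conjTranspose_mul, Matrix.conjTranspose_conjTranspose, hρ.1.eq, hT.1.eq]
      rw [Matrix.trace_mul_comm]
    rw [h2] at h1
    simp only [Matrix.mul_add, Matrix.mul_sub, Matrix.mul_smul, Matrix.trace_add,
      Matrix.trace_sub, Matrix.trace_smul, Complex.add_re, Complex.sub_re, smul_eq_mul,
      Complex.re_ofReal_mul, h3] at h1
    linarith
  have := discrim_le_zero key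
  unfold discrim at this
  linarith

lemma dist_core {a b ap bp f1 f2 r N ε p1 p2 : ℝ} (hN : 0 < N) (hε : 0 ≤ ε)
    (hr : 0 ≤ r) (hF : (1 - ε ^ 2) * N ≤ r ^ 2)
    (c1 : f1 ^ 2 ≤ a * p1) (c2 : f2 ^ 2 ≤ b * p2) (m1 : p1 ≤ N * ap) (m2 : p2 ≤ N * bp)
    (n1 : 0 ≤ a) (n2 : 0 ≤ b) (n3 : 0 ≤ ap) (n4 : 0 ≤ bp)
    (hs1 : b = 1 - a) (hs2 : bp = 1 - ap) (hs3 : f2 = r - f1) : a - ap ≤ ε := by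
  have g1 : f1 ≤ Real.sqrt (N * (a * ap)) := by
    apply Real.le_sqrt_of_sq_le
    calc f1 ^ 2 ≤ _ := c1
      _ ≤ a * (N * ap) := mul_le_mul_of_nonneg_left m1 n1
      _ = _ := by ring
  have g2 : f2 ≤ Real.sqrt (N * (b * bp)) := by
    apply Real.le_sqrt_of_sq_le
    calc f2 ^ 2 ≤ _ := c2
      _ ≤ b * (N * bp) := mul_le_mul_of_nonneg_left m2 n2
      _ = _ := by ring
  rw [Real.sqrt_mul hN.le] at g1 g2
  have hrr : r ≤ Real.sqrt N * (Real.sqrt (a * ap) + Real.sqrt (b * bp)) := by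
    linarith
  have hsq : r ^ 2 ≤ N * (Real.sqrt (a * ap) + Real.sqrt (b * bp)) ^ 2 := by
    calc r ^ 2
        ≤ (Real.sqrt N * (Real.sqrt (a * ap) + Real.sqrt (b * bp))) ^ 2 :=
          pow_le_pow_left₀ hr hrr 2
      _ = _ := by rw [mul_pow, Real.sq_sqrt hN.le]
  have h5 : 1 - ε ^ 2 ≤ (Real.sqrt (a * ap) + Real.sqrt (b * bp)) ^ 2 := by
    have := hF.trans hsq
    rw [mul_comm] at this
    exact le_of_mul_le_mul_left this hN
  rw [Real.sqrt_mul n1, Real.sqrt_mul n2] at h5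
  have q1 := Real.sq_sqrt n1
  have q2 := Real.sq_sqrt n2
  have q3 := Real.sq_sqrt n3
  have q4 := Real.sq_sqrt n4
  set x := Real.sqrt a
  set y := Real.sqrt b
  set z := Real.sqrt ap
  set w := Real.sqrt bp
  have hx : 0 ≤ x := Real.sqrt_nonneg _
  have hy : 0 ≤ y := Real.sqrt_nonneg _
  have hz : 0 ≤ z := Real.sqrt_nonneg _
  have hw : 0 ≤ w := Real.sqrt_nonneg _
  have u1 : x ^ 2 + y ^ 2 = 1 := by rw [q1, q2]; linarith
  have u2 : z ^ 2 + w ^ 2 = 1 := by rw [q3, q4]; linarith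
  have e1 : (x * z + y * w) ^ 2 + (x * w - y * z) ^ 2 = 1 := by
    calc _ = (x ^ 2 + y ^ 2) * (z ^ 2 + w ^ 2) := by ring
      _ = 1 := by rw [u1, u2]; ring
  have e2 : (x * w - y * z) ^ 2 ≤ ε ^ 2 := by linarith
  have e3 : x * w - y * z ≤ ε := le_trans (le_abs_self _) (abs_le_of_sq_le_sq e2 hε)
  have e4 : x * w + y * z ≤ 1 := by nlinarith [sq_nonneg (x - w), sq_nonneg (y - z)]
  have e5 : a - ap = (x * w - y * z) * (x * w + y * z) := by
    have : (x * w - y * z) * (x * w + y * z) = x ^ 2 * w ^ 2 - y ^ 2 * z ^ 2 := by ring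
    rw [this]
    have hw2 : w ^ 2 = 1 - z ^ 2 := by linarith
    have hy2 : y ^ 2 = 1 - x ^ 2 := by linarith
    rw [hw2, hy2, ← q1, ← q3]; ring
  rw [e5]
  have e6 : 0 ≤ x * w + y * z := by positivity
  nlinarith [mul_le_mul_of_nonneg_right e3 e6]

/-- A Fuchs–van de Graaf type bound. -/
lemma dist_bound {ρ ρ' K : Matrix d d ℂ} (hρ : IsDensity ρ) (hρ' : IsDensity ρ') {N ε : ℝ}
    (hN : 0 < N) (hε : 0 ≤ ε) (hdom : (N • ρ' - K * ρ * Kᴴ).PosSemidef)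
    (hr : 0 ≤ (K * ρ).trace.re) (hF : (1 - ε ^ 2) * N ≤ (K * ρ).trace.re ^ 2) :
    (1 / 2) * traceNorm (ρ - ρ') ≤ ε := by
  have hH : (ρ - ρ').IsHermitian := hρ.1.1.sub hρ'.1.1
  obtain ⟨Q, hQ1, hQ2, hQ3⟩ := traceNorm_test hH (by rw [Matrix.trace_sub, hρ.2, hρ'.2]; simp)
  have hQp : Q.PosSemidef := proj_psd hQ1 hQ2
  have hQc : (1 - Q).PosSemidef := by
    apply proj_psd
    · rw [Matrix.conjTranspose_sub, hQ1, Matrix.conjTranspose_one]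
    · rw [Matrix.sub_mul, Matrix.mul_sub, Matrix.mul_sub, hQ2]; simp
  have c1 := cs_test hQp hρ.1 K
  have c2 := cs_test hQc hρ.1 K
  have m1 := tr_mul_mono hQp hdom
  have m2 := tr_mul_mono hQc hdom
  have n1 := tr_mul_nonneg hQp hρ.1
  have n2 := tr_mul_nonneg hQc hρ.1
  have n3 := tr_mul_nonneg hQp hρ'.1
  have n4 := tr_mul_nonneg hQc hρ'.1
  rw [hQ3, Matrix.mul_sub, Matrix.trace_sub, Complex.sub_re]
  have s : ∀ X : Matrix d d ℂ, ((1 - Q) * X).trace.re = X.trace.re - (Q * X).trace.re := by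
    intro X
    rw [Matrix.sub_mul, Matrix.one_mul, Matrix.trace_sub, Complex.sub_re]
  rw [Matrix.mul_smul, Matrix.trace_smul, Complex.smul_re, smul_eq_mul] at m1 m2
  have t1 : ρ.trace.re = 1 := by rw [hρ.2]; simp
  have t2 : ρ'.trace.re = 1 := by rw [hρ'.2]; simp
  have hs1 := s ρ
  have hs2 := s ρ'
  have hs3 := s (K * ρ)
  rw [t1] at hs1
  rw [t2] at hs2
  exact dist_core hN hε hr hF c1 c2 m1 m2 n1 n2 n3 n4 hs1 hs2 hs3

/-- The smoothing operator. -/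
lemma exists_smoothing {ρ Λ M : Matrix d d ℂ} (hρ : ρ.PosSemidef) (hΛ : Λ.PosSemidef)
    (hM : M.PosDef) (h1 : (M - Λ).PosSemidef) (h2 : (M - ρ).PosSemidef) :
    ∃ G : Matrix d d ℂ, (1 - Gᴴ * G).PosSemidef ∧ (Λ - G * ρ * Gᴴ).PosSemidef ∧
      ρ.trace.re - (G * ρ).trace.re ≤ M.trace.re - Λ.trace.re ∧
      ∀ P : Matrix d d ℂ, P * Λ = Λ → P * G = G := by
  obtain ⟨S, R, hS, hR, hSS, hRR, hRS⟩ := exists_sqrts hΛ hM.posSemidef h1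
  have hu : IsUnit R := by
    have := hM.isUnit
    rw [← hRR] at this
    exact (isUnit_pow_iff (n := 2) (by norm_num)).1 (by rwa [pow_two])
  have hdet : IsUnit R.det := (Matrix.isUnit_iff_isUnit_det R).1 hu
  have i1 : R⁻¹ * R = 1 := Matrix.nonsing_inv_mul R hdet
  have i2 : R * R⁻¹ = 1 := Matrix.mul_nonsing_inv R hdet
  have hih : (R⁻¹)ᴴ = R⁻¹ := hR.1.inv
  have hSh : Sᴴ = S := hS.1
  have hGh : (S * R⁻¹)ᴴ = R⁻¹ * S := by rw [Matrix.conjTranspose_mul, hih, hSh]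
  have hGM : S * R⁻¹ * M = S * R := by
    rw [← hRR]
    calc S * R⁻¹ * (R * R) = S * (R⁻¹ * R) * R := by simp only [Matrix.mul_assoc]
      _ = _ := by rw [i1, Matrix.mul_one]
  have hGMG : S * R⁻¹ * M * (S * R⁻¹)ᴴ = Λ := by
    rw [hGM, hGh]
    calc S * R * (R⁻¹ * S) = S * (R * R⁻¹) * S := by simp only [Matrix.mul_assoc]
      _ = _ := by rw [i2, Matrix.mul_one, hSS]
  have hcontr : (1 - (S * R⁻¹)ᴴ * (S * R⁻¹)).PosSemidef := by
    have h3 := h1.mul_mul_conjTranspose_same R⁻¹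
    rw [hih] at h3
    have : R⁻¹ * (M - Λ) * R⁻¹ = 1 - (S * R⁻¹)ᴴ * (S * R⁻¹) := by
      rw [hGh, Matrix.mul_sub, Matrix.sub_mul, ← hRR, ← hSS]
      congr 1
      · calc R⁻¹ * (R * R) * R⁻¹ = (R⁻¹ * R) * (R * R⁻¹) := by simp only [Matrix.mul_assoc]
          _ = 1 := by rw [i1, i2, Matrix.mul_one]
      · simp only [Matrix.mul_assoc]
    rwa [this] at h3
  refine ⟨S * R⁻¹, hcontr, ?_, ?_, ?_⟩
  · have h3 := h2.mul_mul_conjTranspose_same (S * R⁻¹)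
    rwa [Matrix.mul_sub, Matrix.sub_mul, hGMG] at h3
  · set G := S * R⁻¹ with hG
    have hC : ((1 : Matrix d d ℂ) + 1 - G - Gᴴ).PosSemidef := by
      have h3 := (Matrix.posSemidef_conjTranspose_mul_self (1 - G)).add hcontr
      have : (1 - G)ᴴ * (1 - G) + (1 - Gᴴ * G) = (1 : Matrix d d ℂ) + 1 - G - Gᴴ := by
        rw [Matrix.conjTranspose_sub, Matrix.conjTranspose_one]
        simp only [Matrix.sub_mul, Matrix.mul_sub, Matrix.one_mul, Matrix.mul_one]
        abel
      rwa [this] at h3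
    have h4 := tr_mul_mono hC h2
    have hform : ∀ X : Matrix d d ℂ, Xᴴ = X →
        (((1 : Matrix d d ℂ) + 1 - G - Gᴴ) * X).trace.re
          = 2 * (X.trace.re - (G * X).trace.re) := by
      intro X hX
      have h5 : (Gᴴ * X).trace.re = (G * X).trace.re := by
        rw [← tr_conj, Matrix.conjTranspose_mul, Matrix.conjTranspose_conjTranspose, hX,
          Matrix.trace_mul_comm]
      simp only [Matrix.sub_mul, Matrix.add_mul, Matrix.one_mul, Matrix.trace_sub,
        Matrix.trace_add, Complex.sub_re, Complex.add_re, h5]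
      ring
    rw [hform ρ hρ.1, hform M hM.1, hGM] at h4
    have h6 := tr_mul_nonneg hS hRS
    rw [Matrix.mul_sub, hSS, Matrix.trace_sub, Complex.sub_re] at h6
    linarith
  · intro P hP
    have h3 : (P * S - S) * (P * S - S)ᴴ = 0 := by
      have e : P * S - S = (P - 1) * S := by rw [Matrix.sub_mul, Matrix.one_mul]
      rw [e, Matrix.conjTranspose_mul, hSh]
      calc (P - 1) * S * (S * (P - 1)ᴴ) = (P - 1) * (S * S) * (P - 1)ᴴ := by
            simp only [Matrix.mul_assoc]
        _ = 0 := by rw [hSS, Matrix.sub_mul, hP]; simp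
    have h4 : P * S - S = 0 := Matrix.self_mul_conjTranspose_eq_zero.1 h3
    rw [← Matrix.mul_assoc, sub_eq_zero.1 h4]

end UB

namespace UB

lemma ptrace2_eq_sum (X : Matrix (A × B) (A × B) ℂ) :
    ptrace2 X = ∑ b : B, X.submatrix (fun a => (a, b)) (fun a => (a, b)) := by
  ext i j
  simp [ptrace2, Matrix.sum_apply]

lemma ptrace2_psd {X : Matrix (A × B) (A × B) ℂ} (h : X.PosSemidef) : (ptrace2 X).PosSemidef := by
  rw [ptrace2_eq_sum]
  exact Matrix.posSemidef_sum _ (fun b _ => h.submatrix _)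

lemma ptrace2_add (X Y : Matrix (A × B) (A × B) ℂ) :
    ptrace2 (X + Y) = ptrace2 X + ptrace2 Y := by
  ext i j
  simp [ptrace2, Finset.sum_add_distrib]

lemma ptrace2_sub (X Y : Matrix (A × B) (A × B) ℂ) :
    ptrace2 (X - Y) = ptrace2 X - ptrace2 Y := by
  ext i j
  simp [ptrace2, Finset.sum_sub_distrib]

lemma ptrace2_smul (t : ℝ) (X : Matrix (A × B) (A × B) ℂ) :
    ptrace2 (t • X) = t • ptrace2 X := by
  ext i j
  simp [ptrace2, Finset.mul_sum]

lemma ptrace2_kron (X : Matrix A A ℂ) (σ : Matrix B B ℂ) (hσ : σ.trace = 1) :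
    ptrace2 (X ⊗ₖ σ) = X := by
  ext i j
  have : ∑ b, σ b b = 1 := hσ
  simp [ptrace2, Matrix.kroneckerMap_apply, ← Finset.mul_sum, this]

lemma ptrace2_trace (X : Matrix (A × B) (A × B) ℂ) : (ptrace2 X).trace = X.trace := by
  simp [ptrace2, Matrix.trace, Fintype.sum_prod_type]

lemma ptrace2_mul_left (X : Matrix A A ℂ) (ρ : Matrix (A × B) (A × B) ℂ) :
    ptrace2 ((X ⊗ₖ (1 : Matrix B B ℂ)) * ρ) = X * ptrace2 ρ := by
  ext i j
  simp only [ptrace2, Matrix.of_apply, Matrix.mul_apply, Matrix.kroneckerMap_apply,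
    Fintype.sum_prod_type, Matrix.one_apply, mul_ite, mul_one, mul_zero, ite_mul, zero_mul,
    Finset.sum_ite_eq, Finset.mem_univ, if_true, Finset.mul_sum]
  rw [Finset.sum_comm]

lemma ptrace2_mul_right (X : Matrix A A ℂ) (ρ : Matrix (A × B) (A × B) ℂ) :
    ptrace2 (ρ * (X ⊗ₖ (1 : Matrix B B ℂ))) = ptrace2 ρ * X := by
  ext i j
  simp only [ptrace2, Matrix.of_apply, Matrix.mul_apply, Matrix.kroneckerMap_apply,
    Fintype.sum_prod_type, Matrix.one_apply, mul_ite, mul_one, mul_zero,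
    Finset.sum_ite_eq', Finset.mem_univ, if_true, Finset.sum_mul]
  rw [Finset.sum_comm]

lemma spectral_cut {R : Matrix d d ℂ} (hR : R.PosSemidef) {α μ : ℝ} (hα0 : 0 < α) (hα : α < 1)
    (hμ : 0 < μ) :
    ∃ P : Matrix d d ℂ, Pᴴ = P ∧ P * P = P ∧ (P * R * P - μ • P).PosSemidef ∧
      R.trace.re - (P * R).trace.re ≤ μ ^ (1 - α) * (matPow R α).trace.re := by
  have hPP : herFun hR.1 (fun x => if μ ≤ x then 1 else 0) *
      herFun hR.1 (fun x => if μ ≤ x then 1 else 0)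
        = herFun hR.1 (fun x => if μ ≤ x then 1 else 0) := by
    rw [herFun_mul]
    apply herFun_congr
    intro i
    split_ifs <;> simp
  have hPR : herFun hR.1 (fun x => if μ ≤ x then 1 else 0) * R
        = herFun hR.1 (fun x => if μ ≤ x then x else 0) := by
    conv_lhs => enter [2]; rw [← herFun_id hR.1]
    rw [herFun_mul]
    apply herFun_congr
    intro i
    split_ifs <;> simp
  refine ⟨herFun hR.1 (fun x => if μ ≤ x then 1 else 0), herFun_isHermitian _ _, hPP, ?_, ?_⟩
  · have : herFun hR.1 (fun x => if μ ≤ x then 1 else 0) * R *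
        herFun hR.1 (fun x => if μ ≤ x then 1 else 0) -
        μ • herFun hR.1 (fun x => if μ ≤ x then 1 else 0)
        = herFun hR.1 (fun x => if μ ≤ x then x - μ else 0) := by
      rw [hPR, herFun_mul, sub_eq_iff_eq_add, ← herFun_smul, herFun_add]
      apply herFun_congr
      intro i
      split_ifs <;> simp
    rw [this]
    apply herFun_posSemidef
    intro i
    split_ifs with h
    · linarith
    · exact le_rfl
  · rw [hPR, matPow_eq hR.1, herFun_trace, herFun_trace]
    have h1 : R.trace.re = ∑ i, hR.1.eigenvalues i := by
      conv_lhs => rw [← herFun_id hR.1]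
      rw [herFun_trace]
    rw [h1, ← Finset.sum_sub_distrib, Finset.mul_sum]
    apply Finset.sum_le_sum
    intro i _
    have h0 := hR.eigenvalues_nonneg i
    generalize hR.1.eigenvalues i = x at h0
    rcases eq_or_lt_of_le h0 with h | h
    · subst h
      simp
    · rw [if_neg h.ne']
      split_ifs with h2
      · rw [sub_self]; positivity
      · rw [sub_zero]
        calc x = x ^ (1 - α) * x ^ α := by rw [← Real.rpow_add h]; simp
          _ ≤ μ ^ (1 - α) * x ^ α := by
            apply mul_le_mul_of_nonneg_right _ (by positivity)
            exact Real.rpow_le_rpow h.le (not_le.1 h2).le (by linarith)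

lemma matPow_trace_pos {R : Matrix d d ℂ} (hR : R.PosSemidef) (h1 : R.trace = 1) (α : ℝ) :
    0 < (matPow R α).trace.re := by
  rw [matPow_eq hR.1, herFun_trace]
  have h2 : R.trace.re = ∑ i, hR.1.eigenvalues i := by
    conv_lhs => rw [← herFun_id hR.1]
    rw [herFun_trace]
  rw [h1, Complex.one_re] at h2
  have h3 : ∃ i, hR.1.eigenvalues i ≠ 0 := by
    by_contra hc
    push Not at hc
    rw [Finset.sum_eq_zero (fun i _ => hc i)] at h2
    exact one_ne_zero h2
  obtain ⟨i, hi⟩ := h3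
  apply Finset.sum_pos'
  · intro j _
    split_ifs
    · exact le_rfl
    · exact Real.rpow_nonneg (hR.eigenvalues_nonneg j) _
  · refine ⟨i, Finset.mem_univ _, ?_⟩
    rw [if_neg hi]
    exact Real.rpow_pos_of_pos (lt_of_le_of_ne (hR.eigenvalues_nonneg i) (Ne.symm hi)) _

lemma pos_part {H : Matrix d d ℂ} (hH : H.IsHermitian) :
    ∃ Q Δ : Matrix d d ℂ, Qᴴ = Q ∧ Q * Q = Q ∧ Δ.PosSemidef ∧ (Δ - H).PosSemidef ∧
      Δ.trace.re = (Q * H).trace.re := by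
  refine ⟨herFun hH (fun x => if 0 < x then 1 else 0), herFun hH (fun x => max x 0),
    herFun_isHermitian _ _, ?_, ?_, ?_, ?_⟩
  · rw [herFun_mul]
    apply herFun_congr
    intro i
    split_ifs <;> simp
  · apply herFun_posSemidef
    intro i
    exact le_max_right _ _
  · have : herFun hH (fun x => max x 0) - H = herFun hH (fun x => max x 0 - x) := by
      rw [sub_eq_iff_eq_add]
      conv_rhs => enter [2]; rw [← herFun_id hH]
      rw [herFun_add]
      apply herFun_congr
      intro i
      simp
    rw [this]
    apply herFun_posSemidef
    intro i
    exact sub_nonneg.2 (le_max_left _ _)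
  · have : herFun hH (fun x => if 0 < x then 1 else 0) * H = herFun hH (fun x => max x 0) := by
      conv_lhs => enter [2]; rw [← herFun_id hH]
      rw [herFun_mul]
      apply herFun_congr
      intro i
      split_ifs with h
      · rw [max_eq_left h.le, one_mul]
      · rw [max_eq_right (not_lt.1 h), zero_mul]
    rw [this]

lemma delta_real {a b Q l β : ℝ} (ha : 0 ≤ a) (hb : 0 ≤ b) (hQ : 0 ≤ Q) (hl : 0 < l) (hβ : 1 < β)
    (h : a ^ β ≤ Q * b ^ (β - 1)) (hab : l * b ≤ a) : a ≤ Q * l ^ (1 - β) := by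
  rcases eq_or_lt_of_le ha with h0 | h0
  · rw [← h0]; positivity
  have h1 : b ≤ a / l := by rw [le_div_iff₀ hl]; linarith
  have h2 : b ^ (β - 1) ≤ (a / l) ^ (β - 1) := Real.rpow_le_rpow hb h1 (by linarith)
  have h3 : a ^ β ≤ Q * (a / l) ^ (β - 1) := h.trans (mul_le_mul_of_nonneg_left h2 hQ)
  rw [Real.div_rpow ha hl.le] at h3
  have h4 : a ^ β = a * a ^ (β - 1) := by
    rw [← Real.rpow_one_add' ha (by linarith)]; ring_nf
  have h5 : l ^ (1 - β) = (l ^ (β - 1))⁻¹ := by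
    rw [← Real.rpow_neg hl.le]; ring_nf
  rw [h4] at h3
  rw [h5]
  have h6 : 0 < a ^ (β - 1) := Real.rpow_pos_of_pos h0 _
  refine le_of_mul_le_mul_right (h3.trans (le_of_eq ?_)) h6
  field_simp

lemma delta_bound {ρ τ P : Matrix d d ℂ} (hρ : ρ.PosSemidef) (hτ : τ.PosSemidef)
    (hs : suppLE ρ τ) (hP1 : Pᴴ = P) (hP2 : P * P = P) {β l : ℝ} (hβ : 1 < β) (hl : 0 < l) :
    ∃ Δ : Matrix d d ℂ, Δ.PosSemidef ∧ (Δ + l • (P * τ * P) - P * ρ * P).PosSemidef ∧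
      Δ.trace.re ≤ QaR β ρ τ * l ^ (1 - β) := by
  have hp1 : (P * ρ * P).PosSemidef := by
    have := hρ.mul_mul_conjTranspose_same P
    rwa [hP1] at this
  have hp2 : (P * τ * P).PosSemidef := by
    have := hτ.mul_mul_conjTranspose_same P
    rwa [hP1] at this
  have hH : (P * ρ * P - l • (P * τ * P)).IsHermitian :=
    hp1.1.sub (psd_real_smul hp2 hl.le).1
  obtain ⟨Q, Δ, hQ1, hQ2, hΔ, hΔ2, hΔ3⟩ := pos_part hH
  have hW : (1 - (P * Q)ᴴ * (P * Q)).PosSemidef := by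
    have e : 1 - (P * Q)ᴴ * (P * Q) = (1 - Q) + Q * (1 - P) * Qᴴ := by
      rw [Matrix.conjTranspose_mul, hQ1, hP1, Matrix.mul_sub, Matrix.sub_mul, Matrix.mul_one, hQ2]
      have : Q * P * (P * Q) = Q * P * Q := by
        rw [Matrix.mul_assoc, ← Matrix.mul_assoc P, hP2, Matrix.mul_assoc]
      rw [this]
      abel
    rw [e]
    have c : ∀ X : Matrix d d ℂ, Xᴴ = X → X * X = X → (1 - X).PosSemidef := by
      intro X h1 h2
      apply proj_psd
      · rw [Matrix.conjTranspose_sub, h1, Matrix.conjTranspose_one]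
      · rw [Matrix.sub_mul, Matrix.mul_sub, Matrix.mul_sub, h2]; simp
    exact (c Q hQ1 hQ2).add ((c P hP1 hP2).mul_mul_conjTranspose_same Q)
  obtain ⟨hq, ht⟩ := holder_test hρ hτ hs hW hβ
  have hWW : P * Q * (P * Q)ᴴ = P * Q * P := by
    rw [Matrix.conjTranspose_mul, hQ1, hP1, Matrix.mul_assoc, ← Matrix.mul_assoc Q, hQ2,
      Matrix.mul_assoc]
  have hcyc : ∀ X : Matrix d d ℂ, (Q * (P * X * P)).trace.re
      = (X * (P * Q * (P * Q)ᴴ)).trace.re := by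
    intro X
    rw [hWW, Matrix.trace_mul_comm]
    congr 1
    rw [Matrix.trace_mul_comm X]
    calc (P * X * P * Q).trace = (P * (X * (P * Q))).trace := by simp only [Matrix.mul_assoc]
      _ = (X * (P * Q) * P).trace := Matrix.trace_mul_comm _ _
      _ = (X * (P * Q * P)).trace := by simp only [Matrix.mul_assoc]
      _ = _ := Matrix.trace_mul_comm _ _
  have hT : (P * Q * (P * Q)ᴴ).PosSemidef := Matrix.posSemidef_self_mul_conjTranspose _
  have ha := tr_mul_nonneg hρ hT
  have hb := tr_mul_nonneg hτ hT
  have htr : Δ.trace.re = (ρ * (P * Q * (P * Q)ᴴ)).trace.re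
      - l * (τ * (P * Q * (P * Q)ᴴ)).trace.re := by
    rw [hΔ3, Matrix.mul_sub, Matrix.trace_sub, Complex.sub_re, Matrix.mul_smul, Matrix.trace_smul,
      Complex.smul_re, hcyc, hcyc, smul_eq_mul]
  have hd := tr_nonneg hΔ
  refine ⟨Δ, hΔ, ?_, ?_⟩
  · have e : Δ + l • (P * τ * P) - P * ρ * P = Δ - (P * ρ * P - l • (P * τ * P)) := by abel
    rw [e]; exact hΔ2
  · have := delta_real ha hb hq hl hβ ht (by linarith)
    have h2 : 0 ≤ l * (τ * (P * Q * (P * Q)ᴴ)).trace.re := mul_nonneg hl.le hb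
    linarith

lemma numeric {ε m D : ℝ} (h0 : 0 < ε) (h1 : ε < 1)
    (hD : D = 1.01 * ((2 - Real.sqrt 3) * ε ^ 2) ^ 2)
    (hm : 1 - 3 * ((2 - Real.sqrt 3) * ε ^ 2) ≤ m) :
    0 < m - D ∧ (1 - ε ^ 2) * (m + 2 * D) ≤ (m - D) ^ 2 := by
  have hs : Real.sqrt 3 ^ 2 = 3 := Real.sq_sqrt (by norm_num)
  have hs0 : 0 ≤ Real.sqrt 3 := Real.sqrt_nonneg 3
  generalize Real.sqrt 3 = s at *
  have hl : 1.732 < s := by nlinarith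
  have hu : s < 1.7321 := by nlinarith
  have he : ε ^ 2 = (2 + s) * ((2 - s) * ε ^ 2) := by nlinarith
  have hp : 0 < (2 - s) * ε ^ 2 := by
    apply mul_pos
    · linarith
    · positivity
  have hq : (2 - s) * ε ^ 2 < 0.268 := by nlinarith
  have hq1 : (2 + s) * ((2 - s) * ε ^ 2) < 1 := by rw [← he]; nlinarith
  generalize (2 - s) * ε ^ 2 = e at *
  rw [he]
  generalize ε ^ 2 = z at *
  have hD1 : 0 < D := by rw [hD]; positivity
  have hmono : 1 - 3 * e - D > 0 := by rw [hD]; nlinarith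
  refine ⟨by linarith, ?_⟩
  have base : (1 - (2 + s) * e) * (1 - 3 * e + 2 * D) ≤ (1 - 3 * e - D) ^ 2 := by
    rw [hD]
    have : 0 ≤ 0.732 - 6.24 * e + 13.46 * e ^ 2 := by nlinarith [sq_nonneg (e - 0.2318)]
    have e3 : 0 < e ^ 3 := by positivity
    have e4 : 0 < e ^ 4 := by positivity
    have x1 : (1 - 3 * e - 1.01 * e ^ 2) ^ 2 - (1 - (2 + s) * e) * (1 - 3 * e + 2 * (1.01 * e ^ 2))
      = e * ((s - 1) + e * (9 - 4.04 - 3 * (2 + s)) + e ^ 2 * (6.06 + 2.02 * (2 + s))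
        + 1.0201 * e ^ 3) := by ring
    have x2 : 0 ≤ (s - 1) + e * (9 - 4.04 - 3 * (2 + s)) + e ^ 2 * (6.06 + 2.02 * (2 + s))
        + 1.0201 * e ^ 3 := by
      nlinarith [mul_pos hp hp]
    have := mul_nonneg hp.le x2
    linarith
  have hd : 0 ≤ (m - (1 - 3 * e)) * ((m - D) + (1 - 3 * e - D) - (1 - (2 + s) * e)) := by
    apply mul_nonneg
    · linarith
    · have : 0 ≤ 2 * (1 - 3 * e - D) - (1 - (2 + s) * e) := by
        rw [hD]; nlinarith
      linarith
  nlinarith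

end UB

namespace UB

lemma exists_smoothing' {ρ Λ Δ : Matrix d d ℂ} (hρ : ρ.PosSemidef) (hΛ : Λ.PosSemidef)
    (hΔ : Δ.PosSemidef) (h : (Δ + Λ - ρ).PosSemidef) {δ : ℝ} (hδ : Δ.trace.re < δ) :
    ∃ G : Matrix d d ℂ, (1 - Gᴴ * G).PosSemidef ∧ (Λ - G * ρ * Gᴴ).PosSemidef ∧
      ρ.trace.re - (G * ρ).trace.re ≤ δ ∧
      ∀ P : Matrix d d ℂ, P * Λ = Λ → P * G = G := by
  obtain ⟨η, hη, hη2⟩ : ∃ η : ℝ, 0 < η ∧ Δ.trace.re + η * (Fintype.card d : ℝ) ≤ δ := by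
    refine ⟨(δ - Δ.trace.re) / (Fintype.card d + 1), ?_, ?_⟩
    · apply div_pos <;> [linarith; positivity]
    · have h1 : (0 : ℝ) < (Fintype.card d : ℝ) + 1 := by positivity
      have h2 : (δ - Δ.trace.re) / (Fintype.card d + 1) * ((Fintype.card d : ℝ) + 1)
          = δ - Δ.trace.re := div_mul_cancel₀ _ h1.ne'
      have h3 : 0 < (δ - Δ.trace.re) / ((Fintype.card d : ℝ) + 1) :=
        div_pos (by linarith) h1
      linarith
  have hη1 : (η • (1 : Matrix d d ℂ)).PosDef := Matrix.PosDef.one.smul hη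
  have hM : (Λ + Δ + η • (1 : Matrix d d ℂ)).PosDef := by
    rw [add_comm]
    exact hη1.add_posSemidef (hΛ.add hΔ)
  obtain ⟨G, g1, g2, g3, g4⟩ := exists_smoothing hρ hΛ hM
    (by
      have e : Λ + Δ + η • (1 : Matrix d d ℂ) - Λ = Δ + η • (1 : Matrix d d ℂ) := by abel
      rw [e]; exact hΔ.add hη1.posSemidef)
    (by
      have e : Λ + Δ + η • (1 : Matrix d d ℂ) - ρ = (Δ + Λ - ρ) + η • (1 : Matrix d d ℂ) := by abel
      rw [e]; exact h.add hη1.posSemidef)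
  refine ⟨G, g1, g2, g3.trans ?_, g4⟩
  have e : (Λ + Δ + η • (1 : Matrix d d ℂ)).trace.re
      = Λ.trace.re + Δ.trace.re + η * (Fintype.card d : ℝ) := by
    simp only [Matrix.trace_add, Matrix.trace_smul, Matrix.trace_one, Complex.add_re,
      Complex.smul_re, Complex.natCast_re, smul_eq_mul]
  rw [e]
  linarith

lemma ptrace2_mono_kron {X Y : Matrix A A ℂ} {σ : Matrix B B ℂ} (h : (Y - X).PosSemidef)
    (hσ : σ.PosSemidef) : (Y ⊗ₖ σ - X ⊗ₖ σ).PosSemidef := by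
  have e : Y ⊗ₖ σ - X ⊗ₖ σ = (Y - X) ⊗ₖ σ := by
    ext i j
    simp [Matrix.kroneckerMap_apply, sub_mul]
  rw [e]
  exact h.kronecker hσ

/-- The unnormalised smoothed state and its properties. -/
lemma smooth_un {R : Matrix (A × B) (A × B) ℂ} {σ : Matrix B B ℂ} {PA : Matrix A A ℂ}
    {G : Matrix (A × B) (A × B) ℂ} {l μ : ℝ}
    (hR : R.PosSemidef) (hσ : IsDensity σ) (hl : 0 < l) (hμ : 0 < μ)
    (hcut : (ptrace2 R - μ • PA).PosSemidef)
    (hG : (1 - Gᴴ * G).PosSemidef) (hdom : (l • (PA ⊗ₖ σ) - G * R * Gᴴ).PosSemidef) :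
    ∃ S : Matrix (A × B) (A × B) ℂ, S.PosSemidef ∧ (S - G * R * Gᴴ).PosSemidef ∧
      S.trace.re ≤ 3 * R.trace.re - 2 * (G * R).trace.re ∧
      ((2 * l / μ + 1) • (ptrace2 S ⊗ₖ σ) - S).PosSemidef := by
  have hE : (G * R * Gᴴ).PosSemidef := hR.mul_mul_conjTranspose_same G
  have hD : ((1 - G) * R * (1 - G)ᴴ).PosSemidef := hR.mul_mul_conjTranspose_same (1 - G)
  have hF : ((G + G - 1) * R * (G + G - 1)ᴴ).PosSemidef :=
    hR.mul_mul_conjTranspose_same (G + G - 1)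
  have eF : (G + G - 1) * R * (G + G - 1)ᴴ
      = (2 : ℝ) • (G * R * Gᴴ + (1 - G) * R * (1 - G)ᴴ) - R := by
    rw [two_smul]
    simp only [Matrix.conjTranspose_sub, Matrix.conjTranspose_add, Matrix.conjTranspose_one,
      Matrix.sub_mul, Matrix.mul_sub, Matrix.add_mul, Matrix.mul_add, Matrix.one_mul,
      Matrix.mul_one]
    abel
  rw [eF] at hF
  have tD : ((1 - G) * R * (1 - G)ᴴ).trace.re
      = R.trace.re - 2 * (G * R).trace.re + (G * R * Gᴴ).trace.re := by
    have h3 : (R * Gᴴ).trace.re = (G * R).trace.re := by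
      rw [← tr_conj (R * Gᴴ)]
      simp only [Matrix.conjTranspose_mul, Matrix.conjTranspose_conjTranspose, hR.1.eq]
    simp only [Matrix.conjTranspose_sub, Matrix.conjTranspose_one,
      Matrix.sub_mul, Matrix.mul_sub, Matrix.one_mul,
      Matrix.mul_one, Matrix.trace_sub, Complex.sub_re, h3]
    ring
  have tE : (G * R * Gᴴ).trace.re ≤ R.trace.re := by
    have := tr_mul_nonneg hR hG
    rw [Matrix.mul_sub, Matrix.mul_one, Matrix.trace_sub, Complex.sub_re] at this
    have e : (G * R * Gᴴ).trace = (R * (Gᴴ * G)).trace := by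
      rw [Matrix.mul_assoc, Matrix.trace_mul_comm, Matrix.mul_assoc]
    rw [e]; linarith
  generalize G * R * Gᴴ = E at *
  generalize (1 - G) * R * (1 - G)ᴴ = D at *
  have hDA := ptrace2_psd hD
  have hk : (ptrace2 D ⊗ₖ σ).PosSemidef := hDA.kronecker hσ.1
  have hpS : ptrace2 (E + ptrace2 D ⊗ₖ σ) = ptrace2 E + ptrace2 D := by
    rw [ptrace2_add, ptrace2_kron _ _ hσ.2]
  refine ⟨E + ptrace2 D ⊗ₖ σ, hE.add hk, by rwa [add_sub_cancel_left], ?_, ?_⟩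
  · have e : (E + ptrace2 D ⊗ₖ σ).trace = E.trace + D.trace := by
      rw [← ptrace2_trace, hpS, Matrix.trace_add, ptrace2_trace, ptrace2_trace]
    rw [e, Complex.add_re, tD]
    linarith
  · rw [hpS]
    -- the marginal dominates the projector
    have hF2 := ptrace2_psd hF
    rw [ptrace2_sub, ptrace2_smul, ptrace2_add] at hF2
    have h1 := hF2.add hcut
    have h2 : ((2 * l / μ) • (ptrace2 E + ptrace2 D) - l • PA).PosSemidef := by
      have h3 := psd_real_smul h1 (div_pos hl hμ).le
      have e : (l / μ) • ((2 : ℝ) • (ptrace2 E + ptrace2 D) - ptrace2 R + (ptrace2 R - μ • PA))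
          = (2 * l / μ) • (ptrace2 E + ptrace2 D) - l • PA := by
        have h4 : (2 : ℝ) • (ptrace2 E + ptrace2 D) - ptrace2 R + (ptrace2 R - μ • PA)
          = (2 : ℝ) • (ptrace2 E + ptrace2 D) - μ • PA := by abel
        rw [h4, smul_sub, smul_smul, smul_smul]
        congr 2
        · ring
        · field_simp
      rwa [e] at h3
    have h3 : ((2 * l / μ + 1) • (ptrace2 E + ptrace2 D) - (l • PA + ptrace2 D)).PosSemidef := by
      have e : (2 * l / μ + 1) • (ptrace2 E + ptrace2 D) - (l • PA + ptrace2 D)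
          = ((2 * l / μ) • (ptrace2 E + ptrace2 D) - l • PA) + ptrace2 E := by
        rw [add_smul, one_smul]; abel
      rw [e]
      exact h2.add (ptrace2_psd hE)
    have h4 := (ptrace2_mono_kron h3 hσ.1).add hdom
    rw [Matrix.smul_kronecker, Matrix.add_kronecker (l • PA), Matrix.smul_kronecker] at h4
    have e : (2 * l / μ + 1) • ((ptrace2 E + ptrace2 D) ⊗ₖ σ) - (E + ptrace2 D ⊗ₖ σ)
      = (2 * l / μ + 1) • ((ptrace2 E + ptrace2 D) ⊗ₖ σ) - (l • (PA ⊗ₖ σ) + ptrace2 D ⊗ₖ σ)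
        + (l • (PA ⊗ₖ σ) - E) := by abel
    rw [e]
    exact h4

lemma smooth_state {ρ : Matrix (A × B) (A × B) ℂ} {σ : Matrix B B ℂ} {PA : Matrix A A ℂ}
    {Δ : Matrix (A × B) (A × B) ℂ} {l μ δ ε : ℝ}
    (hρ : IsDensity ρ) (hσ : IsDensity σ) (hl : 0 < l) (hμ : 0 < μ) (hε0 : 0 < ε) (hε : ε < 1)
    (hP1 : PAᴴ = PA) (hP2 : PA * PA = PA)
    (hcut : (PA * ptrace2 ρ * PA - μ • PA).PosSemidef)
    (hΔ : Δ.PosSemidef) (hδ : Δ.trace.re < δ)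
    (hdel : (Δ + l • (PA ⊗ₖ σ)
      - (PA ⊗ₖ (1 : Matrix B B ℂ)) * ρ * (PA ⊗ₖ (1 : Matrix B B ℂ))).PosSemidef)
    (hm : 0 < (PA * ptrace2 ρ).trace.re - δ)
    (hnum : (1 - ε ^ 2) * ((PA * ptrace2 ρ).trace.re + 2 * δ)
      ≤ ((PA * ptrace2 ρ).trace.re - δ) ^ 2) :
    ∃ ρ' : Matrix (A × B) (A × B) ℂ, IsDensity ρ' ∧ (1 / 2) * traceNorm (ρ - ρ') ≤ ε ∧
      ((2 * l / μ + 1) • (ptrace2 ρ' ⊗ₖ σ) - ρ').PosSemidef := by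
  have hp1 : (PA ⊗ₖ (1 : Matrix B B ℂ))ᴴ = PA ⊗ₖ (1 : Matrix B B ℂ) := by
    rw [Matrix.conjTranspose_kronecker, hP1, Matrix.conjTranspose_one]
  have hp2 : (PA ⊗ₖ (1 : Matrix B B ℂ)) * (PA ⊗ₖ (1 : Matrix B B ℂ))
      = PA ⊗ₖ (1 : Matrix B B ℂ) := by
    rw [← Matrix.mul_kronecker_mul, hP2, Matrix.mul_one]
  have hp3 : (PA ⊗ₖ (1 : Matrix B B ℂ)) * (l • (PA ⊗ₖ σ)) = l • (PA ⊗ₖ σ) := by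
    rw [Matrix.mul_smul, ← Matrix.mul_kronecker_mul, hP2, Matrix.one_mul]
  have hpt : ptrace2 ((PA ⊗ₖ (1 : Matrix B B ℂ)) * ρ * (PA ⊗ₖ (1 : Matrix B B ℂ)))
      = PA * ptrace2 ρ * PA := by rw [ptrace2_mul_right, ptrace2_mul_left]
  have hcut' := hcut
  rw [← hpt] at hcut'
  have htr : ((PA ⊗ₖ (1 : Matrix B B ℂ)) * ρ * (PA ⊗ₖ (1 : Matrix B B ℂ))).trace
      = (PA * ptrace2 ρ).trace := by
    rw [← ptrace2_trace, hpt, Matrix.trace_mul_comm, ← Matrix.mul_assoc, hP2]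
  have hΛ : (l • (PA ⊗ₖ σ)).PosSemidef :=
    psd_real_smul ((proj_psd hP1 hP2).kronecker hσ.1) hl.le
  generalize PA ⊗ₖ (1 : Matrix B B ℂ) = P at *
  have hR : (P * ρ * P).PosSemidef := by
    have := hρ.1.mul_mul_conjTranspose_same P
    rwa [hp1] at this
  obtain ⟨G, g1, g2, g3, g4⟩ := exists_smoothing' hR hΛ hΔ hdel hδ
  have hPG : P * G = G := g4 P hp3
  obtain ⟨S, s1, s2, s3, s4⟩ := smooth_un hR hσ hl hμ hcut' g1 g2
  rw [htr] at s3 g3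
  have eK1 : (G * P) * ρ * (G * P)ᴴ = G * (P * ρ * P) * Gᴴ := by
    rw [Matrix.conjTranspose_mul, hp1]
    simp only [Matrix.mul_assoc]
  have eK2 : ((G * P) * ρ).trace.re = (G * (P * ρ * P)).trace.re := by
    congr 1
    calc ((G * P) * ρ).trace = ((P * G) * P * ρ).trace := by rw [hPG]
      _ = (P * (G * (P * ρ))).trace := by simp only [Matrix.mul_assoc]
      _ = (G * (P * ρ) * P).trace := Matrix.trace_mul_comm _ _
      _ = _ := by simp only [Matrix.mul_assoc]
  have hcs := cs_test (Matrix.PosSemidef.one (n := A × B) (R := ℂ)) hρ.1 (G * P)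
  rw [Matrix.one_mul, Matrix.one_mul, Matrix.one_mul, eK1, eK2, hρ.2, Complex.one_re, one_mul]
    at hcs
  have hS2 := tr_nonneg s2
  rw [Matrix.trace_sub, Complex.sub_re] at hS2
  rw [← eK1] at s2
  have hr : 0 < (G * (P * ρ * P)).trace.re := by linarith
  have hN : 0 < S.trace.re := by
    have := pow_pos hr 2
    linarith
  have hSc : S.trace = ((S.trace.re : ℝ) : ℂ) := by
    apply Complex.ext
    · simp
    · have := s1.trace_nonneg
      rw [Complex.le_def] at this
      simpa using this.2.symm
  have hε2 : 0 < 1 - ε ^ 2 := by nlinarith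
  have hfin : (1 - ε ^ 2) * S.trace.re ≤ (G * (P * ρ * P)).trace.re ^ 2 := by
    calc (1 - ε ^ 2) * S.trace.re ≤ (1 - ε ^ 2) * ((PA * ptrace2 ρ).trace.re + 2 * δ) :=
          mul_le_mul_of_nonneg_left (by linarith) hε2.le
      _ ≤ _ := hnum
      _ ≤ _ := pow_le_pow_left₀ hm.le (by linarith) 2
  have hden : IsDensity ((S.trace.re)⁻¹ • S) := by
    refine ⟨psd_real_smul s1 (inv_pos.2 hN).le, ?_⟩
    rw [Matrix.trace_smul, Complex.real_smul]
    conv_lhs => enter [2]; rw [hSc]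
    rw [← Complex.ofReal_mul, inv_mul_cancel₀ hN.ne', Complex.ofReal_one]
  refine ⟨(S.trace.re)⁻¹ • S, hden, ?_, ?_⟩
  · apply dist_bound (K := G * P) hρ hden hN hε0.le
    · rwa [smul_smul, mul_inv_cancel₀ hN.ne', one_smul]
    · rw [eK2]; exact hr.le
    · rw [eK2]; exact hfin
  · have := psd_real_smul s4 (inv_pos.2 hN).le
    rw [ptrace2_smul, Matrix.smul_kronecker, smul_comm, ← smul_sub]
    exact this

end UB

namespace UB

lemma log_bound {α β e T Q : ℝ} (hα0 : 0 < α) (hα : α < 1) (hβ : 1 < β) (he : 0 < e)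
    (hT : 0 < T) (hQ : 0 < Q) :
    Real.log (3 * (Q / e ^ 2) ^ (1 / (β - 1)) / (3 * e / T) ^ (1 / (1 - α)))
      ≤ 1 / (1 - α) * Real.log T + (β - 1)⁻¹ * Real.log Q
        + (2 / (β - 1) + 1 / (1 - α)) * Real.log (1 / e) := by
  have hl : 0 < (Q / e ^ 2) ^ (1 / (β - 1)) := by positivity
  have hμ : 0 < (3 * e / T) ^ (1 / (1 - α)) := by positivity
  rw [Real.log_div (by positivity) hμ.ne', Real.log_mul (by norm_num) hl.ne',
    Real.log_rpow (by positivity), Real.log_rpow (by positivity),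
    Real.log_div hQ.ne' (by positivity), Real.log_div (by positivity) hT.ne',
    Real.log_mul (by norm_num) he.ne', Real.log_pow, one_div e, Real.log_inv]
  have h3 : 0 < Real.log 3 := Real.log_pos (by norm_num)
  have h4 : 1 ≤ 1 / (1 - α) := by
    rw [le_div_iff₀ (by linarith)]; linarith
  have h5 : Real.log 3 ≤ 1 / (1 - α) * Real.log 3 := le_mul_of_one_le_left h3.le h4
  have h6 : 2 / (β - 1) = 2 * (1 / (β - 1)) := by ring
  have h7 : (β - 1)⁻¹ = 1 / (β - 1) := by ring
  rw [h6, h7]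
  push_cast
  nlinarith

lemma per_sigma {ε α β : ℝ} (hε0 : 0 < ε) (hε : ε < 1) (hα0 : 0 < α) (hα : α < 1) (hβ : 1 < β)
    {ρ : Matrix (A × B) (A × B) ℂ} (hρ : IsDensity ρ) {σ : Matrix B B ℂ} (hσ : IsDensity σ)
    (hs : suppLE ρ ((1 : Matrix A A ℂ) ⊗ₖ σ)) :
    ImaxSmooth ε ρ ≤ ((renyiEntropy α (ptrace2 ρ)
      + (β - 1)⁻¹ * Real.log (QaR β ρ ((1 : Matrix A A ℂ) ⊗ₖ σ))
      + (2 / (β - 1) + 1 / (1 - α)) * Real.log (1 / ((2 - Real.sqrt 3) * ε ^ 2)) : ℝ) : EReal) := by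
  obtain ⟨e, hedef⟩ : ∃ e : ℝ, e = (2 - Real.sqrt 3) * ε ^ 2 := ⟨_, rfl⟩
  have hs3 : Real.sqrt 3 ^ 2 = 3 := Real.sq_sqrt (by norm_num)
  have hs0 : 0 ≤ Real.sqrt 3 := Real.sqrt_nonneg 3
  have hsl : 1.732 < Real.sqrt 3 := by nlinarith
  have hsu : Real.sqrt 3 < 1.7321 := by nlinarith
  have he : 0 < e := by
    rw [hedef]
    apply mul_pos
    · linarith
    · positivity
  have heu : e < 0.268 := by rw [hedef]; nlinarith
  have hRA : (ptrace2 ρ).PosSemidef := ptrace2_psd hρ.1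
  have hRt : (ptrace2 ρ).trace = 1 := by rw [ptrace2_trace, hρ.2]
  have hT := matPow_trace_pos hRA hRt α
  obtain ⟨T, hTdef⟩ : ∃ T : ℝ, T = (matPow (ptrace2 ρ) α).trace.re := ⟨_, rfl⟩
  rw [← hTdef] at hT
  obtain ⟨μ, hμdef⟩ : ∃ μ : ℝ, μ = (3 * e / T) ^ (1 / (1 - α)) := ⟨_, rfl⟩
  have hμ : 0 < μ := by rw [hμdef]; positivity
  obtain ⟨PA, hP1, hP2, hcut, hm⟩ := spectral_cut hRA hα0 hα hμ
  have hμT : μ ^ (1 - α) * (matPow (ptrace2 ρ) α).trace.re = 3 * e := by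
    rw [← hTdef, hμdef, ← Real.rpow_mul (by positivity), one_div_mul_cancel (by linarith),
      Real.rpow_one]
    field_simp
  rw [hμT, hRt, Complex.one_re] at hm
  obtain ⟨m, hmdef⟩ : ∃ m : ℝ, m = (PA * ptrace2 ρ).trace.re := ⟨_, rfl⟩
  rw [← hmdef] at hm
  obtain ⟨hnum1, hnum2⟩ := numeric (m := m) hε0 hε rfl (by rw [← hedef]; linarith)
  rw [← hedef] at hnum1 hnum2
  have hp1 : (PA ⊗ₖ (1 : Matrix B B ℂ))ᴴ = PA ⊗ₖ (1 : Matrix B B ℂ) := by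
    rw [Matrix.conjTranspose_kronecker, hP1, Matrix.conjTranspose_one]
  have hp2 : (PA ⊗ₖ (1 : Matrix B B ℂ)) * (PA ⊗ₖ (1 : Matrix B B ℂ))
      = PA ⊗ₖ (1 : Matrix B B ℂ) := by
    rw [← Matrix.mul_kronecker_mul, hP2, Matrix.mul_one]
  have hτ : ((1 : Matrix A A ℂ) ⊗ₖ σ).PosSemidef := Matrix.PosSemidef.one.kronecker hσ.1
  have hW : (1 - (PA ⊗ₖ (1 : Matrix B B ℂ))ᴴ * (PA ⊗ₖ (1 : Matrix B B ℂ))).PosSemidef := by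
    rw [hp1, hp2]
    apply proj_psd
    · rw [Matrix.conjTranspose_sub, hp1, Matrix.conjTranspose_one]
    · rw [Matrix.sub_mul, Matrix.mul_sub, Matrix.mul_sub, hp2]; simp
  obtain ⟨hQ0, hQ1⟩ := holder_test hρ.1 hτ hs hW hβ
  rw [hp1, hp2] at hQ1
  have ht1 : (ρ * (PA ⊗ₖ (1 : Matrix B B ℂ))).trace.re = m := by
    rw [← ptrace2_trace, ptrace2_mul_right, Matrix.trace_mul_comm, hmdef]
  have ht2 : ((1 : Matrix A A ℂ) ⊗ₖ σ * (PA ⊗ₖ (1 : Matrix B B ℂ))).trace.re = PA.trace.re := by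
    rw [← Matrix.mul_kronecker_mul, Matrix.one_mul, Matrix.mul_one, Matrix.trace_kronecker, hσ.2,
      mul_one]
  rw [ht1, ht2] at hQ1
  have hPk : μ * PA.trace.re ≤ m := by
    have h1 := tr_nonneg hcut
    have h2 : (PA * ptrace2 ρ * PA).trace = (PA * ptrace2 ρ).trace := by
      rw [Matrix.trace_mul_comm, ← Matrix.mul_assoc, hP2]
    rw [Matrix.trace_sub, Complex.sub_re, h2, ← hmdef, Matrix.trace_smul, Complex.smul_re,
      smul_eq_mul] at h1
    linarith
  obtain ⟨Q, hQdef⟩ : ∃ Q : ℝ, Q = QaR β ρ ((1 : Matrix A A ℂ) ⊗ₖ σ) := ⟨_, rfl⟩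
  rw [← hQdef] at hQ0 hQ1
  have hm0 : e ^ 2 ≤ m := by nlinarith
  have he2 : 0 < e ^ 2 := by positivity
  have hmQ : m ≤ Q * μ ^ (1 - β) :=
    delta_real (he2.le.trans hm0) (tr_nonneg (proj_psd hP1 hP2)) hQ0 hμ hβ hQ1 hPk
  have hQ : 0 < Q := by
    rcases eq_or_lt_of_le hQ0 with h | h
    · rw [← h, zero_mul] at hmQ
      linarith
    · exact h
  obtain ⟨l, hldef⟩ : ∃ l : ℝ, l = (Q / e ^ 2) ^ (1 / (β - 1)) := ⟨_, rfl⟩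
  have hl : 0 < l := by rw [hldef]; positivity
  have hlp : l ^ (β - 1) = Q / e ^ 2 := by
    rw [hldef, ← Real.rpow_mul (by positivity), one_div_mul_cancel (by linarith), Real.rpow_one]
  have hneg : ∀ x : ℝ, 0 < x → x ^ (1 - β) = (x ^ (β - 1))⁻¹ := by
    intro x hx
    rw [← Real.rpow_neg hx.le]; ring_nf
  have hμl : μ ≤ l := by
    have h1 : μ ^ (β - 1) ≤ l ^ (β - 1) := by
      rw [hlp, le_div_iff₀ he2]
      rw [hneg μ hμ, ← div_eq_mul_inv, le_div_iff₀ (by positivity)] at hmQ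
      have : 0 < μ ^ (β - 1) := by positivity
      nlinarith
    exact (Real.rpow_le_rpow_iff hμ.le hl.le (by linarith)).1 h1
  obtain ⟨Δ, hΔ1, hΔ2, hΔ3⟩ := delta_bound hρ.1 hτ hs hp1 hp2 hβ hl
  have hΔe : Δ.trace.re ≤ e ^ 2 := by
    rw [← hQdef, hneg l hl, hlp] at hΔ3
    have : Q * (Q / e ^ 2)⁻¹ = e ^ 2 := by field_simp
    linarith
  have hPτ : (PA ⊗ₖ (1 : Matrix B B ℂ)) * ((1 : Matrix A A ℂ) ⊗ₖ σ) * (PA ⊗ₖ (1 : Matrix B B ℂ))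
      = PA ⊗ₖ σ := by
    rw [← Matrix.mul_kronecker_mul, ← Matrix.mul_kronecker_mul, Matrix.mul_one, hP2,
      Matrix.one_mul, Matrix.mul_one]
  rw [hPτ] at hΔ2
  rw [hmdef] at hnum1 hnum2
  obtain ⟨ρ', r1, r2, r3⟩ := smooth_state hρ hσ hl hμ hε0 hε hP1 hP2 hcut hΔ1
    (by linarith : Δ.trace.re < 1.01 * e ^ 2) hΔ2 hnum1 hnum2
  have ht0 : 0 < 2 * l / μ + 1 := by positivity
  have hlog : Real.log (2 * l / μ + 1) ≤ renyiEntropy α (ptrace2 ρ)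
      + (β - 1)⁻¹ * Real.log (QaR β ρ ((1 : Matrix A A ℂ) ⊗ₖ σ))
      + (2 / (β - 1) + 1 / (1 - α)) * Real.log (1 / ((2 - Real.sqrt 3) * ε ^ 2)) := by
    have h1 := log_bound hα0 hα hβ he hT hQ
    rw [← hldef, ← hμdef] at h1
    have h2 : Real.log (2 * l / μ + 1) ≤ Real.log (3 * l / μ) := by
      apply Real.log_le_log ht0
      have : 1 ≤ l / μ := by rwa [le_div_iff₀ hμ, one_mul]
      have e1 : 2 * l / μ = 2 * (l / μ) := by ring
      have e2 : 3 * l / μ = 3 * (l / μ) := by ring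
      rw [e1, e2]; linarith
    unfold renyiEntropy
    rw [← hedef, ← hQdef, ← hTdef]
    exact h2.trans h1
  refine le_trans ?_ (EReal.coe_le_coe_iff.2 hlog)
  calc ImaxSmooth ε ρ ≤ Imax ρ' :=
        iInf_le (fun ρ' : {ρ' : Matrix (A × B) (A × B) ℂ //
          IsDensity ρ' ∧ (1/2) * traceNorm (ρ - ρ') ≤ ε} => Imax ρ'.1) ⟨ρ', r1, r2⟩
    _ ≤ Dmax ρ' (ptrace2 ρ' ⊗ₖ σ) :=
        iInf_le (fun σ : {σ : Matrix B B ℂ // IsDensity σ} =>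
          Dmax ρ' (ptrace2 ρ' ⊗ₖ σ.1)) ⟨σ, hσ⟩
    _ ≤ ENNReal.log (ENNReal.ofReal (2 * l / μ + 1)) := by
        apply ENNReal.log_monotone
        apply sInf_le
        refine ⟨ENNReal.ofReal_ne_top, ?_⟩
        rw [ENNReal.toReal_ofReal ht0.le]
        exact r3
    _ = _ := ENNReal.log_ofReal_of_pos ht0

lemma ereal_assemble {ι : Type*} (x : EReal) (h f : ℝ) (D : ι → EReal)
    (H : ∀ i, x ≤ ((h + f : ℝ) : EReal) + D i) : x ≤ (h : EReal) - -(⨅ i, D i) + (f : EReal) := by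
  have h1 : (h : EReal) - -(⨅ i, D i) + (f : EReal) = ((h + f : ℝ) : EReal) + ⨅ i, D i := by
    rw [sub_eq_add_neg, neg_neg, EReal.coe_add, add_right_comm]
  rw [h1]
  have h2 : ∀ y : EReal, x ≤ ((h + f : ℝ) : EReal) + y ↔ x - ((h + f : ℝ) : EReal) ≤ y := by
    intro y
    rw [EReal.sub_le_iff_le_add (Or.inl (EReal.coe_ne_bot _)) (Or.inl (EReal.coe_ne_top _)),
      add_comm]
  rw [h2]
  exact le_iInf fun i => (h2 _).1 (H i)

end UB

/-- **Universal upper bound on the smoothed max mutual information**: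
`I_max^ε(A:B)_ρ ≤ H_α(A)_ρ − H̃_β↑(A|B)_ρ + f_{α,β}(ε)` with
`f_{α,β}(ε) = (2/(β−1) + 1/(1−α))·log(1/(c ε²))`, `c = 2 − √3`. -/
theorem ImaxSmooth_universal_bound (ε α β : ℝ)
    (hε : ε ∈ Set.Ioo (0 : ℝ) 1) (hα : α ∈ Set.Ioo (0 : ℝ) 1) (hβ : 1 < β)
    (ρ : Matrix (A × B) (A × B) ℂ) (hρ : IsDensity ρ) :
    ImaxSmooth ε ρ
      ≤ ((renyiEntropy α (ptrace2 ρ) : ℝ) : EReal) - HbetaUp β ρ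
        + (((2 / (β - 1) + 1 / (1 - α))
            * Real.log (1 / ((2 - Real.sqrt 3) * ε ^ 2)) : ℝ) : EReal) := by
  unfold HbetaUp
  apply UB.ereal_assemble
  intro σ
  unfold Dbeta
  split_ifs with hs
  · have h := UB.per_sigma hε.1 hε.2 hα.1 hα.2 hβ hρ σ.2 hs
    rw [← EReal.coe_add]
    refine h.trans (le_of_eq ?_)
    congr 1
    ring
  · rw [EReal.coe_add_top]
    exact le_top
end
end

section
/- Let ε, α ∈ (0,1) and let ρ be a density matrix on a bipartite system A⊗B. Then I_max^ε(A:B)_ρ ≤ H_α(A)_ρ − H_min^{cε²}(A|B)_ρ + (1/(1−α))·log(1/(c·ε²)), where c := 2 − √3 and H_min^δ(A|B)_ρ := −min over density matrices σ on B and density matrices ρ̃ on A⊗B with (1/2)‖ρ − ρ̃‖₁ ≤ δ of D_max(ρ̃ ‖ I_A ⊗ σ). -/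
open scoped Matrix Kronecker BigOperators ENNReal ComplexOrder Classical

noncomputable section

variable {d : Type*} [Fintype d] [DecidableEq d]

variable {A B : Type*} [Fintype A] [DecidableEq A] [Fintype B] [DecidableEq B]

/-- Smoothed optimized conditional min-entropy
`H_min^δ(A|B)_ρ = −min { D_max(ρ̃ ‖ I_A ⊗ σ) : σ density on B, (1/2)‖ρ − ρ̃‖₁ ≤ δ }`. -/
def HminSmooth (δ : ℝ) (ρ : Matrix (A × B) (A × B) ℂ) : EReal :=
  -(⨅ x : {x : Matrix B B ℂ × Matrix (A × B) (A × B) ℂ //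
      IsDensity x.1 ∧ IsDensity x.2 ∧ (1/2) * traceNorm (ρ - x.2) ≤ δ},
    Dmax x.1.2 ((1 : Matrix A A ℂ) ⊗ₖ x.1.1))

/-! ### Basic functional calculus facts -/

lemma herFun_mul {X : Matrix d d ℂ} (hX : X.IsHermitian) (f g : ℝ → ℝ) :
    herFun hX f * herFun hX g = herFun hX (fun x => f x * g x) := by
  have hU : (hX.eigenvectorUnitary : Matrix d d ℂ)ᴴ * (hX.eigenvectorUnitary : Matrix d d ℂ) = 1 :=
    Unitary.coe_star_mul_self hX.eigenvectorUnitary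
  unfold herFun
  rw [show ∀ a b c e f g : Matrix d d ℂ, a * b * c * (e * f * g) = a * b * (c * e) * f * g by
    intros; simp only [Matrix.mul_assoc], hU]
  simp only [Matrix.mul_one, Matrix.mul_assoc,
    Matrix.diagonal_mul_diagonal, Complex.ofReal_mul]

lemma herFun_sub {X : Matrix d d ℂ} (hX : X.IsHermitian) (f g : ℝ → ℝ) :
    herFun hX f - herFun hX g = herFun hX (fun x => f x - g x) := by
  unfold herFun
  rw [← Matrix.sub_mul, ← Matrix.mul_sub, Matrix.diagonal_sub]
  simp

lemma herFun_id {X : Matrix d d ℂ} (hX : X.IsHermitian) : herFun hX (fun x => x) = X := by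
  conv_rhs => rw [hX.spectral_theorem]
  rfl

lemma herFun_const {X : Matrix d d ℂ} (hX : X.IsHermitian) (c : ℝ) :
    herFun hX (fun _ => c) = (c : ℂ) • (1 : Matrix d d ℂ) := by
  have hU : (hX.eigenvectorUnitary : Matrix d d ℂ) * (hX.eigenvectorUnitary : Matrix d d ℂ)ᴴ = 1 :=
    Unitary.coe_mul_star_self hX.eigenvectorUnitary
  unfold herFun
  rw [show (Matrix.diagonal fun _ : d => (c : ℂ)) = (c : ℂ) • (1 : Matrix d d ℂ) by
    rw [Matrix.smul_one_eq_diagonal]]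
  simp [hU]

lemma herFun_trace {X : Matrix d d ℂ} (hX : X.IsHermitian) (f : ℝ → ℝ) :
    (herFun hX f).trace = ((∑ i, f (hX.eigenvalues i) : ℝ) : ℂ) := by
  have hU : (hX.eigenvectorUnitary : Matrix d d ℂ)ᴴ * (hX.eigenvectorUnitary : Matrix d d ℂ) = 1 :=
    Unitary.coe_star_mul_self hX.eigenvectorUnitary
  unfold herFun
  rw [Matrix.trace_mul_comm, ← Matrix.mul_assoc, hU]
  simp [Matrix.trace_diagonal]

lemma herFun_posSemidef {X : Matrix d d ℂ} (hX : X.IsHermitian) (f : ℝ → ℝ)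
    (hf : ∀ i, 0 ≤ f (hX.eigenvalues i)) : (herFun hX f).PosSemidef := by
  unfold herFun
  refine Matrix.PosSemidef.mul_mul_conjTranspose_same (Matrix.PosSemidef.diagonal ?_) _
  intro i
  simpa using hf i

lemma herFun_isHermitian {X : Matrix d d ℂ} (hX : X.IsHermitian) (f : ℝ → ℝ) :
    (herFun hX f).IsHermitian := by
  unfold herFun
  refine Matrix.isHermitian_mul_mul_conjTranspose _ ?_
  rw [Matrix.IsHermitian, Matrix.diagonal_conjTranspose]
  congr 1
  ext i
  simp

lemma herFun_eq_cfc {X : Matrix d d ℂ} (hX : X.IsHermitian) (f : ℝ → ℝ) :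
    herFun hX f = cfc f X := by
  rw [hX.cfc_eq]
  rfl

lemma traceNorm_hermitian {X : Matrix d d ℂ} (hX : X.IsHermitian) :
    traceNorm X = ∑ i, |hX.eigenvalues i| := by
  have hXX : (Xᴴ * X).IsHermitian := Matrix.isHermitian_conjTranspose_mul_self X
  have e : matPow (Xᴴ * X) (1/2) = herFun hX (fun x => |x|) := by
    unfold matPow matFun
    rw [dif_pos hXX, herFun_eq_cfc, herFun_eq_cfc]
    have h2 : Xᴴ * X = cfc (fun x : ℝ => x * x) X := by
      rw [← herFun_eq_cfc hX, ← herFun_mul, herFun_id, hX.eq]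
    have hfin : ∀ (Y : Matrix d d ℂ), Y.IsHermitian → (spectrum ℝ Y).Finite := fun Y hY => by
      rw [hY.spectrum_real_eq_range_eigenvalues]; exact Set.finite_range _
    have hcomp : ∀ f : ℝ → ℝ, cfc f (cfc (fun x : ℝ => x * x) X) = cfc (fun x => f (x * x)) X := by
      intro f
      exact (cfc_comp' f (fun x : ℝ => x * x) X (((hfin X hX).image _).continuousOn _)
        (by fun_prop) hX).symm
    rw [h2, hcomp]
    apply cfc_congr
    intro x _
    by_cases hx : x = 0
    · simp [hx]
    · have h4 : Real.rpow (x * x) (1/2) = |x| := by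
        rw [← Real.sqrt_mul_self_eq_abs, Real.sqrt_eq_rpow]; rfl
      simpa [hx] using h4
  rw [traceNorm, e, herFun_trace, Complex.ofReal_re]

lemma posSemidef_exists_root {X : Matrix d d ℂ} (hX : X.PosSemidef) :
    ∃ R : Matrix d d ℂ, X = Rᴴ * R := by
  refine ⟨herFun hX.1 Real.sqrt, ?_⟩
  rw [(herFun_isHermitian hX.1 _).eq, herFun_mul]
  conv_lhs => rw [← herFun_id hX.1]
  unfold herFun
  congr 3
  ext i
  have := Real.mul_self_sqrt (hX.eigenvalues_nonneg i)
  simp only [this]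

lemma trace_mul_nonneg' {X Y : Matrix d d ℂ} (hX : X.PosSemidef) (hY : Y.PosSemidef) :
    0 ≤ (X * Y).trace.re := by
  obtain ⟨R, rfl⟩ := posSemidef_exists_root hY
  rw [← Matrix.mul_assoc, Matrix.trace_mul_comm, ← Matrix.mul_assoc]
  exact (Complex.le_def.mp (hX.mul_mul_conjTranspose_same R).trace_nonneg).1

lemma traceNorm_test {X E : Matrix d d ℂ} (hX : X.IsHermitian) (htr : X.trace = 0)
    (hE : E.PosSemidef) (hE1 : (1 - E).PosSemidef) :
    (E * X).trace.re ≤ (1/2) * traceNorm X := by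
  have hsum : ∑ i, hX.eigenvalues i = 0 := by
    have := herFun_trace hX (fun x => x)
    rw [herFun_id, htr] at this
    exact_mod_cast this.symm
  set P := herFun hX (fun x => max x 0) with hP
  have hP0 : P.PosSemidef := herFun_posSemidef hX _ (fun i => le_max_right _ _)
  have hPX : (P - X).PosSemidef := by
    have e : P - X = herFun hX (fun x => max x 0 - x) := by
      rw [← herFun_sub, herFun_id]
    rw [e]
    exact herFun_posSemidef hX _ (fun i => sub_nonneg.mpr (le_max_left _ _))
  have h1 := trace_mul_nonneg' hE hPX
  have h2 := trace_mul_nonneg' hE1 hP0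
  have h3 : P.trace.re = (1/2) * traceNorm X := by
    rw [traceNorm_hermitian hX, hP, herFun_trace, Complex.ofReal_re]
    have : ∀ x : ℝ, max x 0 = (1/2) * (|x| + x) := by
      intro x
      rcases le_total x 0 with h | h
      · rw [max_eq_right h, abs_of_nonpos h]; ring
      · rw [max_eq_left h, abs_of_nonneg h]; ring
    simp only [this]
    rw [← Finset.mul_sum, Finset.sum_add_distrib, hsum, add_zero]
  simp only [Matrix.mul_sub, Matrix.sub_mul, Matrix.one_mul, Matrix.trace_sub, Complex.sub_re] at h1 h2
  linarith

lemma traceNorm_le_of_test {X : Matrix d d ℂ} (hX : X.IsHermitian) (htr : X.trace = 0) (r : ℝ)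
    (h : ∀ E : Matrix d d ℂ, E.PosSemidef → (1 - E).PosSemidef → (E * X).trace.re ≤ r) :
    (1/2) * traceNorm X ≤ r := by
  have hsum : ∑ i, hX.eigenvalues i = 0 := by
    have := herFun_trace hX (fun x => x)
    rw [herFun_id, htr] at this
    exact_mod_cast this.symm
  have key := h (herFun hX (fun x => if 0 < x then 1 else 0))
    (herFun_posSemidef hX _ (fun i => by split_ifs <;> norm_num))
    (by
      have h1 : (1 : Matrix d d ℂ) = herFun hX (fun _ => 1) := by simp [herFun_const]
      rw [h1, herFun_sub]
      exact herFun_posSemidef hX _ (fun i => by split_ifs <;> norm_num))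
  have e : herFun hX (fun x => if 0 < x then 1 else 0) * X
      = herFun hX (fun x => (1/2) * (|x| + x)) := by
    have e' : ∀ f, herFun hX f * X = herFun hX (fun x => f x * x) := fun f => by
      rw [← herFun_mul, herFun_id]
    rw [e']
    congr 1
    ext x
    split_ifs with hx
    · rw [abs_of_pos hx]; ring
    · rw [abs_of_nonpos (not_lt.mp hx)]; ring
  rw [e, herFun_trace, Complex.ofReal_re, ← Finset.mul_sum, Finset.sum_add_distrib, hsum,
    add_zero] at key
  rwa [traceNorm_hermitian hX]

set_option linter.unusedSectionVars false

/-! ### Gentle measurement -/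

lemma gentle_expand (P Q ρ : Matrix d d ℂ) (x y : ℝ) :
    (x • P + y • Q) * ρ * (x • P + y • Q) = (x * x) • (P * ρ * P) + (x * y) • (P * ρ * Q)
      + (x * y) • (Q * ρ * P) + (y * y) • (Q * ρ * Q) := by
  simp only [Matrix.add_mul, Matrix.mul_add, Matrix.smul_mul, Matrix.mul_smul]
  module

lemma gentle_pos {ρ P E : Matrix d d ℂ} (hρ : IsDensity ρ) (hP : P.IsHermitian) (hPP : P * P = P)
    (hE : E.PosSemidef) (hE1 : (1 - E).PosSemidef) (s : ℝ) (hs0 : 0 < s) (hs1 : s < 1)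
    (hη : ((1 - P) * ρ).trace.re = s ^ 2) :
    (E * (ρ - (1 - s ^ 2)⁻¹ • (P * ρ * P))).trace.re ≤ s := by
  set Q := 1 - P with hQ
  have hQh : Q.IsHermitian := Matrix.isHermitian_one.sub hP
  have hQQ : Q * Q = Q := by
    rw [hQ, Matrix.sub_mul, Matrix.one_mul, Matrix.mul_sub, hPP]; simp
  have hPQ : P * Q = 0 := by rw [hQ, Matrix.mul_sub, hPP, Matrix.mul_one, sub_self]
  have hQP : Q * P = 0 := by rw [hQ, Matrix.sub_mul, hPP, Matrix.one_mul, sub_self]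
  obtain ⟨a, ha0, ha⟩ : ∃ a : ℝ, 0 < a ∧ a * a = (1 - s) / 2 :=
    ⟨√((1 - s) / 2), Real.sqrt_pos.mpr (by linarith), Real.mul_self_sqrt (by linarith)⟩
  obtain ⟨b, hb0, hb⟩ : ∃ b : ℝ, 0 < b ∧ b * b = (1 + s) / 2 :=
    ⟨√((1 + s) / 2), Real.sqrt_pos.mpr (by linarith), Real.mul_self_sqrt (by linarith)⟩
  have hia : (2 * a)⁻¹ * (2 * a)⁻¹ = (2 * (1 - s))⁻¹ := by
    rw [← mul_inv]; congr 1; linear_combination 4 * ha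
  have hib : (2 * b)⁻¹ * (2 * b)⁻¹ = (2 * (1 + s))⁻¹ := by
    rw [← mul_inv]; congr 1; linear_combination 4 * hb
  have h1s : (1 - s) ≠ 0 := by linarith
  have h1s' : (1 + s) ≠ 0 := by linarith
  have h1s2 : (1 - s ^ 2) ≠ 0 := by nlinarith
  set W := (2 * b)⁻¹ • P + (b / s) • Q with hW
  set Z := (2 * a)⁻¹ • P + (-(a / s)) • Q with hZ
  have hrho : ρ = P * ρ * P + P * ρ * Q + Q * ρ * P + Q * ρ * Q := by
    rw [hQ]; noncomm_ring
  have hid : ρ - (1 - s ^ 2)⁻¹ • (P * ρ * P) = s • (W * ρ * W - Z * ρ * Z) := by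
    have e1 : s * ((2 * b)⁻¹ * (2 * b)⁻¹ - (2 * a)⁻¹ * (2 * a)⁻¹) = 1 - (1 - s ^ 2)⁻¹ := by
      rw [hia, hib]
      rw [show (1 - s ^ 2) = (1 - s) * (1 + s) by ring]
      field_simp
      ring
    have e2 : s * ((2 * b)⁻¹ * (b / s) - (2 * a)⁻¹ * (-(a / s))) = 1 := by
      field_simp; norm_num
    have e3 : s * ((b / s) * (b / s) - (-(a / s)) * (-(a / s))) = 1 := by
      have : s * ((b / s) * (b / s) - (-(a / s)) * (-(a / s))) = (b * b - a * a) / s := by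
        field_simp; try ring
      rw [this, ha, hb]; field_simp; ring
    calc ρ - (1 - s ^ 2)⁻¹ • (P * ρ * P)
        = (1 - (1 - s ^ 2)⁻¹) • (P * ρ * P) + (1 : ℝ) • (P * ρ * Q) + (1 : ℝ) • (Q * ρ * P)
          + (1 : ℝ) • (Q * ρ * Q) := by
          nth_rewrite 1 [hrho]; module
      _ = _ := by
          rw [hW, hZ, gentle_expand, gentle_expand, ← e1]
          nth_rewrite 1 [← e2]
          nth_rewrite 1 [← e2]
          nth_rewrite 1 [← e3]
          module
  have hWh : W.IsHermitian := by
    rw [Matrix.IsHermitian, hW]; simp [hP.eq, hQh.eq]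
  have hZh : Z.IsHermitian := by
    rw [Matrix.IsHermitian, hZ]; simp [hP.eq, hQh.eq]
  have hWp : (W * ρ * W).PosSemidef := by
    have := hρ.1.mul_mul_conjTranspose_same W
    rwa [hWh.eq] at this
  have hZp : (Z * ρ * Z).PosSemidef := by
    have := hρ.1.mul_mul_conjTranspose_same Z
    rwa [hZh.eq] at this
  have hsand : ∀ M N : Matrix d d ℂ, (M * ρ * N).trace = (N * M * ρ).trace := by
    intro M N; rw [Matrix.trace_mul_comm, Matrix.mul_assoc]
  have hPtr : (P * ρ).trace.re = 1 - s ^ 2 := by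
    have : P = 1 - Q := by rw [hQ]; abel
    rw [this, Matrix.sub_mul, Matrix.trace_sub, Matrix.one_mul, hρ.2, Complex.sub_re, hη]
    simp
  have hWtr : (W * ρ * W).trace.re = 1 := by
    rw [hW, gentle_expand]
    simp only [Matrix.trace_add, Matrix.trace_smul, hsand, hPP, hQQ, hPQ, hQP, Matrix.zero_mul,
      Matrix.trace_zero, Complex.add_re, Complex.real_smul, Complex.re_ofReal_mul, hPtr, hη, hib,
      smul_zero, Complex.zero_re]
    have : b / s * (b / s) * s ^ 2 = b * b := by field_simp
    rw [this, hb, show (1 - s ^ 2) = (1 - s) * (1 + s) by ring]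
    field_simp
    ring
  have h1 := trace_mul_nonneg' hE hZp
  have h2 := trace_mul_nonneg' hE1 hWp
  rw [Matrix.sub_mul, Matrix.one_mul, Matrix.trace_sub, Complex.sub_re, hWtr] at h2
  rw [hid, Matrix.mul_smul, Matrix.trace_smul, Complex.real_smul, Complex.re_ofReal_mul,
    Matrix.mul_sub, Matrix.trace_sub, Complex.sub_re]
  nlinarith

lemma gentle {ρ P E : Matrix d d ℂ} (hρ : IsDensity ρ) (hP : P.IsHermitian) (hPP : P * P = P)
    (hE : E.PosSemidef) (hE1 : (1 - E).PosSemidef) (η : ℝ) (hη1 : η < 1)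
    (hη : ((1 - P) * ρ).trace.re = η) :
    (E * (ρ - (1 - η)⁻¹ • (P * ρ * P))).trace.re ≤ √η := by
  have hQh : (1 - P).IsHermitian := Matrix.isHermitian_one.sub hP
  have hQQ : (1 - P) * (1 - P) = 1 - P := by
    rw [Matrix.sub_mul, Matrix.one_mul, Matrix.mul_sub, hPP]; simp
  have hQp : ((1 - P) * ρ * (1 - P)).PosSemidef := by
    have := hρ.1.mul_mul_conjTranspose_same (1 - P)
    rwa [hQh.eq] at this
  have htr : ((1 - P) * ρ * (1 - P)).trace = ((1 - P) * ρ).trace := by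
    rw [Matrix.trace_mul_comm, ← Matrix.mul_assoc, hQQ]
  have hη0 : 0 ≤ η := by
    rw [← hη, ← htr]; exact (Complex.le_def.mp hQp.trace_nonneg).1
  rcases hη0.eq_or_lt with h0 | hpos
  · have hz : (1 - P) * ρ * (1 - P) = 0 := by
      rw [← hQp.trace_eq_zero_iff]
      apply Complex.ext
      · rw [htr, hη, ← h0]; simp
      · exact (Complex.le_def.mp hQp.trace_nonneg).2.symm
    obtain ⟨R, hR⟩ := posSemidef_exists_root hρ.1
    have hRQ : R * (1 - P) = 0 := by
      rw [← Matrix.conjTranspose_mul_self_eq_zero, Matrix.conjTranspose_mul, hQh.eq]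
      rw [hR] at hz
      simpa only [Matrix.mul_assoc] using hz
    have hρQ : ρ * (1 - P) = 0 := by rw [hR, Matrix.mul_assoc, hRQ, Matrix.mul_zero]
    have hρP : ρ * P = ρ := by
      rw [Matrix.mul_sub, Matrix.mul_one, sub_eq_zero] at hρQ; exact hρQ.symm
    have hPρ : P * ρ = ρ := by
      have := congrArg Matrix.conjTranspose hρP
      rwa [Matrix.conjTranspose_mul, hP.eq, hρ.1.1.eq] at this
    rw [hPρ, hρP, ← h0]
    simp
  · have hs : √η ^ 2 = η := Real.sq_sqrt hη0
    have hlt : √η < 1 := by rw [Real.sqrt_lt' one_pos]; simpa using hη1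
    have := gentle_pos hρ hP hPP hE hE1 (√η) (Real.sqrt_pos.mpr hpos) hlt (by rw [hs, hη])
    rwa [hs] at this

/-! ### Partial trace -/

lemma ptrace2_trace (X : Matrix (A × B) (A × B) ℂ) : (ptrace2 X).trace = X.trace := by
  simp [ptrace2, Matrix.trace, Fintype.sum_prod_type]

lemma ptrace2_smul (c : ℝ) (X : Matrix (A × B) (A × B) ℂ) : ptrace2 (c • X) = c • ptrace2 X := by
  ext i j
  simp [ptrace2, Finset.mul_sum]

lemma ptrace2_sub (X Y : Matrix (A × B) (A × B) ℂ) :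
    ptrace2 (X - Y) = ptrace2 X - ptrace2 Y := by
  ext i j
  simp [ptrace2]

lemma kron_one_mul_apply (M : Matrix A A ℂ) (X : Matrix (A × B) (A × B) ℂ) (i : A) (b : B)
    (z : A × B) : ((M ⊗ₖ (1 : Matrix B B ℂ)) * X) (i, b) z = ∑ k, M i k * X (k, b) z := by
  rw [Matrix.mul_apply, Fintype.sum_prod_type]
  simp [Matrix.kroneckerMap_apply, Matrix.one_apply]

lemma mul_kron_one_apply (M : Matrix A A ℂ) (X : Matrix (A × B) (A × B) ℂ) (i : A) (b : B)
    (z : A × B) : (X * (M ⊗ₖ (1 : Matrix B B ℂ))) z (i, b) = ∑ k, X z (k, b) * M k i := by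
  rw [Matrix.mul_apply, Fintype.sum_prod_type]
  simp [Matrix.kroneckerMap_apply, Matrix.one_apply]

lemma ptrace2_kron_mul (M : Matrix A A ℂ) (X : Matrix (A × B) (A × B) ℂ) :
    ptrace2 ((M ⊗ₖ (1 : Matrix B B ℂ)) * X) = M * ptrace2 X := by
  ext i j
  simp only [ptrace2, Matrix.of_apply, kron_one_mul_apply]
  simp only [Matrix.mul_apply, Matrix.of_apply, Finset.mul_sum]
  rw [Finset.sum_comm]

lemma ptrace2_mul_kron (M : Matrix A A ℂ) (X : Matrix (A × B) (A × B) ℂ) :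
    ptrace2 (X * (M ⊗ₖ (1 : Matrix B B ℂ))) = ptrace2 X * M := by
  ext i j
  simp only [ptrace2, Matrix.of_apply, mul_kron_one_apply]
  simp only [Matrix.mul_apply, Matrix.of_apply, Finset.sum_mul]
  rw [Finset.sum_comm]

lemma ptrace2_posSemidef {X : Matrix (A × B) (A × B) ℂ} (hX : X.PosSemidef) :
    (ptrace2 X).PosSemidef := by
  have : ptrace2 X = ∑ b : B, X.submatrix (fun i => (i, b)) (fun i => (i, b)) := by
    ext i j
    simp [ptrace2, Matrix.sum_apply]
  rw [this]
  exact Matrix.posSemidef_sum _ (fun b _ => hX.submatrix _)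

/-! ### Spectral cut -/

lemma spectral_cut {T : Matrix d d ℂ} (hT : T.PosSemidef) (μ : ℝ) (hμ : 0 < μ) :
    ∃ P : Matrix d d ℂ, P.PosSemidef ∧ P * P = P ∧ (P * T * P - μ • P).PosSemidef ∧
      (T - (1 - P) * T).PosSemidef ∧ (μ • (1 : Matrix d d ℂ) - (1 - P) * T).PosSemidef ∧
      (1 - P).PosSemidef ∧
      ∀ α ∈ Set.Ioo (0 : ℝ) 1, ((1 - P) * T).trace.re + μ * P.trace.re
        ≤ μ ^ (1 - α) * (matPow T α).trace.re := by
  have hid := herFun_id hT.1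
  have h1 : herFun hT.1 (fun _ => 1) = 1 := by simp [herFun_const]
  have hsm : ∀ f : ℝ → ℝ, μ • herFun hT.1 f = herFun hT.1 (fun x => μ * f x) := by
    intro f
    rw [← herFun_mul, herFun_const]
    simp only [Matrix.smul_mul, Matrix.one_mul]
    ext i j; simp
  set p : ℝ → ℝ := fun x => if x < μ then 0 else 1 with hp
  have e1 : 1 - herFun hT.1 p = herFun hT.1 (fun x => 1 - p x) := by rw [← herFun_sub, h1]
  have e2 : (1 - herFun hT.1 p) * T = herFun hT.1 (fun x => (1 - p x) * x) := by
    rw [e1, ← herFun_mul, hid]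
  refine ⟨herFun hT.1 p, ?_, ?_, ?_, ?_, ?_, ?_, ?_⟩
  · exact herFun_posSemidef _ _ (fun i => by simp only [hp]; split_ifs <;> norm_num)
  · rw [herFun_mul]; congr 1; ext x; simp [hp]
  · have : herFun hT.1 p * T * herFun hT.1 p - μ • herFun hT.1 p
        = herFun hT.1 (fun x => p x * x * p x - μ * p x) := by
      rw [← herFun_sub, ← hsm, ← herFun_mul hT.1 (fun x => p x * x), ← herFun_mul, hid]
    rw [this]
    refine herFun_posSemidef _ _ (fun i => ?_)
    simp only [hp]; split_ifs with h <;> simp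
    linarith
  · have : T - (1 - herFun hT.1 p) * T = herFun hT.1 (fun x => x - (1 - p x) * x) := by
      rw [e2, ← herFun_sub, hid]
    rw [this]
    refine herFun_posSemidef _ _ (fun i => ?_)
    have := hT.eigenvalues_nonneg i
    simp only [hp]; split_ifs with h <;> simp
    exact this
  · have : μ • 1 - (1 - herFun hT.1 p) * T = herFun hT.1 (fun x => μ * 1 - (1 - p x) * x) := by
      rw [e2, ← herFun_sub, ← hsm, h1]
    rw [this]
    refine herFun_posSemidef _ _ (fun i => ?_)
    simp only [hp]; split_ifs with h <;> simp <;> linarith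
  · rw [e1]
    exact herFun_posSemidef _ _ (fun i => by simp only [hp]; split_ifs <;> norm_num)
  · intro α hα
    have e3 : matPow T α = herFun hT.1 (fun x => if x = 0 then 0 else Real.rpow x α) := by
      unfold matPow matFun
      rw [dif_pos hT.1]
    rw [e2, e3, herFun_trace, herFun_trace, herFun_trace, Complex.ofReal_re, Complex.ofReal_re,
      Complex.ofReal_re, Finset.mul_sum, Finset.mul_sum, ← Finset.sum_add_distrib]
    refine Finset.sum_le_sum (fun i _ => ?_)
    have h0 := hT.eigenvalues_nonneg i
    generalize hT.1.eigenvalues i = x at h0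
    have hα' : 0 < 1 - α := by linarith [hα.2]
    rcases h0.eq_or_lt with rfl | hx
    · simp [hp, hμ]
    · rw [if_neg hx.ne']
      change _ ≤ μ ^ (1 - α) * x ^ α
      simp only [hp]
      split_ifs with h
      · calc (1 - 0) * x + μ * 0 = x ^ (1 - α) * x ^ α := by
              rw [← Real.rpow_add hx]; simp
          _ ≤ _ := by
              gcongr
      · push Not at h
        calc (1 - 1) * x + μ * 1 = μ ^ (1 - α) * μ ^ α := by
              rw [← Real.rpow_add hμ]; simp
          _ ≤ _ := by
              have := hα.1
              gcongr

lemma matPow_trace_pos {T : Matrix d d ℂ} (hT : IsDensity T) (α : ℝ) :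
    0 < (matPow T α).trace.re := by
  have e3 : matPow T α = herFun hT.1.1 (fun x => if x = 0 then 0 else Real.rpow x α) := by
    unfold matPow matFun
    rw [dif_pos hT.1.1]
  have hsum : ∑ i, hT.1.1.eigenvalues i = 1 := by
    have := herFun_trace hT.1.1 (fun x => x)
    rw [herFun_id] at this
    exact_mod_cast this.symm.trans hT.2
  rw [e3, herFun_trace, Complex.ofReal_re]
  have hnn : ∀ i, 0 ≤ (if hT.1.1.eigenvalues i = 0 then (0:ℝ)
      else Real.rpow (hT.1.1.eigenvalues i) α) := by
    intro i
    split_ifs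
    · exact le_rfl
    · exact Real.rpow_nonneg (hT.1.eigenvalues_nonneg i) _
  obtain ⟨i, hi⟩ : ∃ i, hT.1.1.eigenvalues i ≠ 0 := by
    by_contra! h
    simp [h] at hsum
  refine Finset.sum_pos' (fun i _ => hnn i) ⟨i, Finset.mem_univ _, ?_⟩
  rw [if_neg hi]
  exact Real.rpow_pos_of_pos (lt_of_le_of_ne (hT.1.eigenvalues_nonneg i) hi.symm) _

lemma sub_kron' (M N : Matrix A A ℂ) (L : Matrix B B ℂ) :
    (M - N) ⊗ₖ L = M ⊗ₖ L - N ⊗ₖ L := by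
  ext i j
  simp [Matrix.kroneckerMap_apply, sub_mul]

/-! ### The smoothed state -/

lemma core (ε α δ μ : ℝ) (hα : α ∈ Set.Ioo (0 : ℝ) 1) (hδ : 2 * δ < 1)
    (hδε : √(2 * δ) + δ ≤ ε) (hμ : 0 < μ)
    (ρ ρt : Matrix (A × B) (A × B) ℂ) (hρ : IsDensity ρ) (hρt : IsDensity ρt)
    (hdist : (1/2) * traceNorm (ρ - ρt) ≤ δ)
    (hμδ : μ ^ (1 - α) * (matPow (ptrace2 ρ) α).trace.re ≤ δ)
    (σ : Matrix B B ℂ) (hσ : IsDensity σ) :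
    ∃ τ : Matrix (A × B) (A × B) ℂ, IsDensity τ ∧ (1/2) * traceNorm (ρ - τ) ≤ ε ∧
      ∀ l : ℝ, 0 ≤ l → (l • ((1 : Matrix A A ℂ) ⊗ₖ σ) - ρt).PosSemidef →
        ((l * μ⁻¹) • (ptrace2 τ ⊗ₖ σ) - τ).PosSemidef := by
  obtain ⟨P, hP, hPP, hPT, hc1, hc2, hP1, -⟩ :=
    spectral_cut (ptrace2_posSemidef hρt.1) μ hμ
  obtain ⟨F, hF, -, -, -, -, hF1, hFα⟩ := spectral_cut (ptrace2_posSemidef hρ.1) μ hμ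
  have hFα := hFα α hα
  have hXh : (ρ - ρt).IsHermitian := hρ.1.1.sub hρt.1.1
  have hXtr : (ρ - ρt).trace = 0 := by rw [Matrix.trace_sub, hρ.2, hρt.2, sub_self]
  have hone : (1 : Matrix A A ℂ) ⊗ₖ (1 : Matrix B B ℂ) = 1 := Matrix.one_kronecker_one
  have kron_compl : ∀ M : Matrix A A ℂ, (1 - M) ⊗ₖ (1 : Matrix B B ℂ) = 1 - M ⊗ₖ 1 := by
    intro M; rw [sub_kron', hone]
  -- tail weight of `ρt`
  set η : ℝ := ((1 - P) * ptrace2 ρt).trace.re with hη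
  have hη2 : η ≤ 2 * δ := by
    -- (1) η ≤ Tr (1-F) ρt_A + μ Tr F
    have a1 := trace_mul_nonneg' hF1 hc1
    have a2 := trace_mul_nonneg' hF hc2
    have e1 : ((1 - F) * (ptrace2 ρt - (1 - P) * ptrace2 ρt)).trace.re
        = ((1 - F) * ptrace2 ρt).trace.re - η + (F * ((1 - P) * ptrace2 ρt)).trace.re := by
      rw [Matrix.mul_sub, Matrix.trace_sub, Complex.sub_re, Matrix.sub_mul 1 F ((1 - P) * ptrace2 ρt),
        Matrix.trace_sub, Complex.sub_re, Matrix.one_mul]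
      ring
    have e2 : (F * (μ • (1 : Matrix A A ℂ) - (1 - P) * ptrace2 ρt)).trace.re
        = μ * F.trace.re - (F * ((1 - P) * ptrace2 ρt)).trace.re := by
      rw [Matrix.mul_sub, Matrix.trace_sub, Complex.sub_re, Matrix.mul_smul, Matrix.mul_one,
        Matrix.trace_smul, Complex.real_smul, Complex.re_ofReal_mul]
    -- (2) Tr (1-F) ρt_A ≤ Tr (1-F) ρ_A + δ
    have a3 := traceNorm_test (E := F ⊗ₖ (1 : Matrix B B ℂ)) hXh hXtr
      (hF.kronecker Matrix.PosSemidef.one)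
      (by rw [← kron_compl]; exact hF1.kronecker Matrix.PosSemidef.one)
    rw [← ptrace2_trace, ptrace2_kron_mul, ptrace2_sub, Matrix.mul_sub, Matrix.trace_sub,
      Complex.sub_re] at a3
    have t1 : (ptrace2 ρ).trace.re = 1 := by rw [ptrace2_trace, hρ.2]; simp
    have t2 : (ptrace2 ρt).trace.re = 1 := by rw [ptrace2_trace, hρt.2]; simp
    rw [e1] at a1
    rw [e2] at a2
    simp only [Matrix.sub_mul 1 F, Matrix.one_mul, Matrix.trace_sub, Complex.sub_re, t1, t2] at a1 hFα
    linarith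
  have hη1 : η < 1 := by linarith
  have hinv : 0 < (1 - η)⁻¹ := inv_pos.mpr (by linarith)
  set K := P ⊗ₖ (1 : Matrix B B ℂ) with hK
  have hKh : K.IsHermitian := (hP.kronecker Matrix.PosSemidef.one).1
  have hKK : K * K = K := by rw [hK, ← Matrix.mul_kronecker_mul, hPP, Matrix.one_mul]
  have hηK : ((1 - K) * ρt).trace.re = η := by
    rw [hK, ← kron_compl, ← ptrace2_trace, ptrace2_kron_mul]
  have hsandwich : ∀ M : Matrix (A × B) (A × B) ℂ, M.PosSemidef → (K * M * K).PosSemidef := by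
    intro M hM
    have := hM.mul_mul_conjTranspose_same K
    rwa [hKh.eq] at this
  have hKρ := hsandwich ρt hρt.1
  have hτ : IsDensity ((1 - η)⁻¹ • (K * ρt * K)) := by
    refine ⟨hKρ.smul hinv.le, ?_⟩
    have htr : (K * ρt * K).trace = ((1 - η : ℝ) : ℂ) := by
      apply Complex.ext
      · rw [Matrix.trace_mul_comm, ← Matrix.mul_assoc, hKK]
        have := hηK
        rw [Matrix.sub_mul, Matrix.one_mul, Matrix.trace_sub, Complex.sub_re, hρt.2] at this
        rw [Complex.ofReal_re]
        simp at this
        linarith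
      · rw [Complex.ofReal_im]
        exact (Complex.le_def.mp hKρ.trace_nonneg).2.symm
    rw [Matrix.trace_smul, htr, Complex.real_smul, ← Complex.ofReal_mul,
      inv_mul_cancel₀ (by linarith), Complex.ofReal_one]
  refine ⟨(1 - η)⁻¹ • (K * ρt * K), hτ, ?_, ?_⟩
  · refine traceNorm_le_of_test (hρ.1.1.sub hτ.1.1) ?_ ε ?_
    · rw [Matrix.trace_sub, hρ.2, hτ.2, sub_self]
    · intro E hE hE1
      have b1 := traceNorm_test hXh hXtr hE hE1
      have b2 := gentle hρt hKh hKK hE hE1 η hη1 hηK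
      have b3 : √η ≤ √(2 * δ) := Real.sqrt_le_sqrt hη2
      have b4 : E * (ρ - (1 - η)⁻¹ • (K * ρt * K))
          = E * (ρ - ρt) + E * (ρt - (1 - η)⁻¹ • (K * ρt * K)) := by
        rw [← Matrix.mul_add]; congr 1; abel
      rw [b4, Matrix.trace_add, Complex.add_re]
      linarith
  · intro l hl hle
    have c1 : (K * (l • ((1 : Matrix A A ℂ) ⊗ₖ σ) - ρt) * K) = l • (P ⊗ₖ σ) - K * ρt * K := by
      rw [Matrix.mul_sub, Matrix.sub_mul, Matrix.mul_smul, Matrix.smul_mul, hK,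
        ← Matrix.mul_kronecker_mul, ← Matrix.mul_kronecker_mul, Matrix.mul_one, Matrix.one_mul,
        hPP, Matrix.mul_one]
    have c2 := hsandwich _ hle
    rw [c1] at c2
    have c3 : ptrace2 (K * ρt * K) = P * ptrace2 ρt * P := by
      rw [hK, ptrace2_mul_kron, ptrace2_kron_mul]
    have c4 := (hPT.kronecker hσ.1).smul (show 0 ≤ l * μ⁻¹ by positivity)
    have c5 := (c4.add c2).smul hinv.le
    have c6 : (1 - η)⁻¹ • ((l * μ⁻¹) • ((P * ptrace2 ρt * P - μ • P) ⊗ₖ σ)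
        + (l • (P ⊗ₖ σ) - K * ρt * K))
        = (l * μ⁻¹) • (ptrace2 ((1 - η)⁻¹ • (K * ρt * K)) ⊗ₖ σ) - (1 - η)⁻¹ • (K * ρt * K) := by
      rw [ptrace2_smul, c3, sub_kron', Matrix.smul_kronecker, Matrix.smul_kronecker]
      have hmm : l = l * μ⁻¹ * μ := by field_simp
      nth_rewrite 2 [hmm]
      module
    rw [← c6]
    exact c5

lemma budget (ε : ℝ) (hε : ε ∈ Set.Ioo (0 : ℝ) 1) :
    0 < (2 - √3) * ε ^ 2 ∧ 2 * ((2 - √3) * ε ^ 2) < 1 ∧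
      √(2 * ((2 - √3) * ε ^ 2)) + (2 - √3) * ε ^ 2 ≤ ε := by
  obtain ⟨h0, h1⟩ := hε
  have hs : √3 ^ 2 = 3 := Real.sq_sqrt (by norm_num)
  have hs1 : √3 < 1.8 := by rw [Real.sqrt_lt' (by norm_num)]; norm_num
  have hs2 : 1.7 < √3 := by rw [Real.lt_sqrt (by norm_num)]; norm_num
  have hc : 0 < 2 - √3 := by linarith
  have he : ε ^ 2 ≤ ε := by nlinarith
  refine ⟨by positivity, by nlinarith, ?_⟩
  have e : 2 * ((2 - √3) * ε ^ 2) = ((√3 - 1) * ε) ^ 2 := by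
    linear_combination (-ε ^ 2) * hs
  rw [e, Real.sqrt_sq (by nlinarith)]
  nlinarith

/-- **Universal bound, min-entropy form**:
`I_max^ε(A:B)_ρ ≤ H_α(A)_ρ − H_min^{cε²}(A|B)_ρ + (1/(1−α))·log(1/(cε²))`, `c = 2 − √3`. -/
theorem ImaxSmooth_le_renyi_sub_HminSmooth (ε α : ℝ)
    (hε : ε ∈ Set.Ioo (0 : ℝ) 1) (hα : α ∈ Set.Ioo (0 : ℝ) 1)
    (ρ : Matrix (A × B) (A × B) ℂ) (hρ : IsDensity ρ) :
    ImaxSmooth ε ρ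
      ≤ ((renyiEntropy α (ptrace2 ρ) : ℝ) : EReal)
        - HminSmooth ((2 - Real.sqrt 3) * ε ^ 2) ρ
        + (((1 / (1 - α)) * Real.log (1 / ((2 - Real.sqrt 3) * ε ^ 2)) : ℝ) : EReal) := by

  obtain ⟨hδ0, hδ1, hδε⟩ := budget ε hε
  set δ := (2 - Real.sqrt 3) * ε ^ 2 with hδ
  have hdA : IsDensity (ptrace2 ρ) :=
    ⟨ptrace2_posSemidef hρ.1, by rw [ptrace2_trace, hρ.2]⟩
  have hS := matPow_trace_pos hdA α
  set S := (matPow (ptrace2 ρ) α).trace.re with hSdef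
  have hα' : 0 < 1 - α := by linarith [hα.2]
  set μ : ℝ := (δ / S) ^ (1 / (1 - α)) with hμdef
  have hμ : 0 < μ := Real.rpow_pos_of_pos (by positivity) _
  have hμδ : μ ^ (1 - α) * S ≤ δ := by
    rw [hμdef, ← Real.rpow_mul (by positivity), one_div_mul_cancel hα'.ne', Real.rpow_one,
      div_mul_cancel₀ _ hS.ne']
  have hlog : renyiEntropy α (ptrace2 ρ) + (1 / (1 - α)) * Real.log (1 / δ) = Real.log μ⁻¹ := by
    rw [renyiEntropy, ← hSdef, Real.log_inv, hμdef, Real.log_rpow (by positivity),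
      Real.log_div hδ0.ne' hS.ne', one_div δ, Real.log_inv]
    ring
  have hrhs : ((renyiEntropy α (ptrace2 ρ) : ℝ) : EReal) - HminSmooth δ ρ
        + (((1 / (1 - α)) * Real.log (1 / δ) : ℝ) : EReal)
      = -HminSmooth δ ρ + ((Real.log μ⁻¹ : ℝ) : EReal) := by
    rw [← hlog, EReal.coe_add, sub_eq_add_neg, add_comm _ (-HminSmooth δ ρ), add_assoc]
  rw [hrhs, HminSmooth, neg_neg, ← EReal.sub_le_iff_le_add (.inl (EReal.coe_ne_bot _))
    (.inl (EReal.coe_ne_top _))]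
  refine le_iInf ?_
  rintro ⟨⟨σ, ρt⟩, hσ, hρt, hdist⟩
  rw [EReal.sub_le_iff_le_add (.inl (EReal.coe_ne_bot _)) (.inl (EReal.coe_ne_top _))]
  obtain ⟨τ, hτ, hτd, hτle⟩ := core ε α δ μ hα hδ1 hδε hμ ρ ρt hρ hρt hdist hμδ σ hσ
  refine (iInf_le _ ⟨τ, hτ, hτd⟩).trans ((iInf_le _ ⟨σ, hσ⟩).trans ?_)
  have hμi : 0 < μ⁻¹ := inv_pos.mpr hμ
  dsimp only
  unfold Dmax
  rw [← ENNReal.log_ofReal_of_pos hμi, ← ENNReal.log_mul_add]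
  apply ENNReal.log_le_log
  rw [← ENNReal.div_le_iff (by simpa using hμ) ENNReal.ofReal_ne_top]
  refine le_sInf ?_
  rintro t ⟨htop, ht⟩
  rw [ENNReal.div_le_iff (by simpa using hμ) ENNReal.ofReal_ne_top]
  refine sInf_le ⟨ENNReal.mul_ne_top htop ENNReal.ofReal_ne_top, ?_⟩
  rw [ENNReal.toReal_mul, ENNReal.toReal_ofReal hμi.le]
  exact hτle _ ENNReal.toReal_nonneg ht
end
end
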